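/- Let q ≥ 3 be a prime power, I an index set, η ∈ F_{q^2} with η^{q+1} = 1, and let L := ⋃_{α ∈ I, u,v ∈ U} ( p(P_{αu}, π_{αv}) \ {r_{U_1}} ). For a line ℓ of PG(3,q^2), the following are equivalent: (i) ℓ ∩ τ_η(ℓ) = ∅, ℓ ∩ Σ_η = ∅, the set S_ℓ := { ⟨Q, τ_η(Q)⟩ ∩ Σ_η : Q ∈ ℓ } is a line-spread of Σ_η, and D_η ∩ S_ℓ is a regulus of Σ_η containing the line r_{U_1} ∩ Σ_η; (ii) at least one of ℓ and τ_η(ℓ) belongs to L. -/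

import Mathlib

open Projectivization Classical

noncomputable section

abbrev Pt (F : Type) [Field F] := Projectivization F (Fin 4 → F)

variable (q : ℕ) (F : Type) [Field F]

/-- The line `t₁ = {(x₁, x₂, 0, 0)}` of `PG(3, q²)`. -/
def t1 : Set (Pt F) := {P | P.rep 2 = 0 ∧ P.rep 3 = 0}

/-- The line `t₂ = {(0, 0, x₃, x₄)}` of `PG(3, q²)`. -/
def t2 : Set (Pt F) := {P | P.rep 0 = 0 ∧ P.rep 1 = 0}

/-- The line `r_{U₁} = {(x₁, 0, x₃, 0)}` of `PG(3, q²)`. -/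
def rU1 : Set (Pt F) := {P | P.rep 1 = 0 ∧ P.rep 3 = 0}

/-- The Baer subgeometry `Σ_α = {(x, y, α xᑫ, α yᑫ)}`. -/
def SigmaSet (α : F) : Set (Pt F) :=
  {P | ∃ (x y : F) (h : ![x, y, α * x ^ q, α * y ^ q] ≠ 0),
    P = Projectivization.mk F ![x, y, α * x ^ q, α * y ^ q] h}

def tauFun (α : F) (v : Fin 4 → F) : Fin 4 → F :=
  ![(v 2) ^ q, (v 3) ^ q, α ^ (q + 1) * (v 0) ^ q, α ^ (q + 1) * (v 1) ^ q]

/-- The collineation `τ_α : (x₁,x₂,x₃,x₄) ↦ (x₃ᑫ, x₄ᑫ, α^{q+1} x₁ᑫ, α^{q+1} x₂ᑫ)`. -/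
def tau (α : F) (P : Pt F) : Pt F :=
  if h : tauFun q F α P.rep ≠ 0 then Projectivization.mk F _ h else P

/-- `s` is (the point set of) a line of `PG(3, q²)`. -/
def isLine (s : Set (Pt F)) : Prop :=
  ∃ W : Submodule F (Fin 4 → F), Module.finrank F W = 2 ∧
    s = {P : Pt F | P.submodule ≤ W}

/-- `s` is (the point set of) a plane of `PG(3, q²)`. -/
def isPlane (s : Set (Pt F)) : Prop :=
  ∃ W : Submodule F (Fin 4 → F), Module.finrank F W = 3 ∧
    s = {P : Pt F | P.submodule ≤ W}

/-- The set of points of the line (or point) spanned by `A` and `B`. -/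
def lineThrough (A B : Pt F) : Set (Pt F) :=
  {P : Pt F | P.submodule ≤ A.submodule ⊔ B.submodule}

/-- For `P = (a, b, 0, 0) ∈ t₁`, `rLine P` is the line through `(a,b,0,0)` and `(0,0,aᑫ,bᑫ)`. -/
def rLine (P : Pt F) : Set (Pt F) := lineThrough F P (tau q F 1 P)

/-- The Desarguesian line-spread `D_α = { r_P ∩ Σ_α : P ∈ t₁ }`. -/
def Dspread (α : F) : Set (Set (Pt F)) :=
  {s | ∃ P ∈ t1 F, s = rLine q F P ∩ SigmaSet q F α}

/-- `U = { u : u^{q+1} = 1 }`. -/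
def Uset : Set F := {u : F | u ^ (q + 1) = 1}

/-- The subfield `F_q` of `F_{q²}`, as a set. -/
def FqSet : Set F := {x : F | x ^ q = x}

/-- The norm image `N = { α^{q+1} : α ∈ I }`. -/
def normIm (I : Set F) : Set F := (fun α : F => α ^ (q + 1)) '' I

/-- `I` is an index set. -/
def IsIndexSet (I : Set F) : Prop :=
  (0 : F) ∉ I ∧
  Set.InjOn (fun α : F => α ^ (q + 1)) I ∧
  (∀ a ∈ normIm q F I, a ∈ FqSet q F) ∧
  (1 : F) ∉ normIm q F I ∧
  normIm q F I ∪ Inv.inv '' normIm q F I ∪ {1} = FqSet q F \ {0} ∧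
  (Even q → normIm q F I ∩ Inv.inv '' normIm q F I = ∅) ∧
  (Odd q → normIm q F I ∩ Inv.inv '' normIm q F I = {-1} ∧
    normIm q F I ∩ Neg.neg '' normIm q F I = ∅)

lemma vec4_ne_zero_fst (a b c d : F) (ha : a ≠ 0) : ![a, b, c, d] ≠ 0 := by
  intro h
  exact ha (by simpa using congrFun h 0)

/-- The point `P_{αu} = (1, 0, αu, 0)`. -/
def Ppt (α u : F) : Pt F :=
  Projectivization.mk F ![1, 0, α * u, 0] (vec4_ne_zero_fst F 1 0 (α * u) 0 one_ne_zero)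

/-- The plane `π_{αv} : X₄ = α v X₂`. -/
def planeSet (α v : F) : Set (Pt F) := {P | P.rep 3 = α * v * P.rep 1}

/-- The Baer subpencil `p(P_{αu}, π_{αv})`: the lines through `P_{αu}` contained in `π_{αv}`
meeting `Σ_α` in `q+1` points. -/
def pencil (α u v : F) : Set (Set (Pt F)) :=
  {ℓ | isLine F ℓ ∧ Ppt F α u ∈ ℓ ∧ ℓ ⊆ planeSet F α v ∧ (ℓ ∩ SigmaSet q F α).ncard = q + 1}

/-- `m` is a line of the Baer subgeometry `Σ_η`. -/
def IsLineOfSigma (η : F) (m : Set (Pt F)) : Prop :=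
  ∃ s : Set (Pt F), isLine F s ∧ m = s ∩ SigmaSet q F η ∧ m.ncard = q + 1

/-- `S` is a line-spread of `Σ_η`. -/
def IsSpreadOfSigma (η : F) (S : Set (Set (Pt F))) : Prop :=
  (∀ m ∈ S, IsLineOfSigma q F η m) ∧
  (∀ m ∈ S, ∀ m' ∈ S, m ≠ m' → m ∩ m' = ∅) ∧
  ⋃₀ S = SigmaSet q F η

/-- `Pl` is a parallelism of `Σ_η`. -/
def IsParallelismOfSigma (η : F) (Pl : Set (Set (Set (Pt F)))) : Prop :=
  (∀ S ∈ Pl, IsSpreadOfSigma q F η S) ∧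
  ∀ m : Set (Pt F), IsLineOfSigma q F η m → ∃! S, S ∈ Pl ∧ m ∈ S

/-- `R` is a regulus of `Σ_η`. -/
def IsRegulusOfSigma (η : F) (R : Set (Set (Pt F))) : Prop :=
  ∃ m1 m2 m3 : Set (Pt F),
    IsLineOfSigma q F η m1 ∧ IsLineOfSigma q F η m2 ∧ IsLineOfSigma q F η m3 ∧
    m1 ∩ m2 = ∅ ∧ m1 ∩ m3 = ∅ ∧ m2 ∩ m3 = ∅ ∧
    R = {m | IsLineOfSigma q F η m ∧
      (m ∩ m1).Nonempty ∧ (m ∩ m2).Nonempty ∧ (m ∩ m3).Nonempty}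

/-- `S_ℓ = { ⟨Q, τ_η(Q)⟩ ∩ Σ_η : Q ∈ ℓ }`. -/
def Sspread (η : F) (ℓ : Set (Pt F)) : Set (Set (Pt F)) :=
  {m | ∃ Q ∈ ℓ, m = lineThrough F Q (tau q F η Q) ∩ SigmaSet q F η}

/-- `R_ℓ = D_η ∩ S_ℓ`. -/
def Rreg (η : F) (ℓ : Set (Pt F)) : Set (Set (Pt F)) :=
  Dspread q F η ∩ Sspread q F η ℓ

/-- `R_ℓᵒ`: the set of lines of `Σ_η` meeting every line of `R_ℓ`. -/
def Ropp (η : F) (ℓ : Set (Pt F)) : Set (Set (Pt F)) :=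
  {m | IsLineOfSigma q F η m ∧ ∀ m' ∈ Rreg q F η ℓ, (m ∩ m').Nonempty}

/-- `G` is a good set (relative to the index set `I`). -/
def IsGoodSet (I : Set F) (G : Finset (F × F × F)) : Prop :=
  G.card = q + 1 ∧
  (∀ t ∈ G, t.1 ∈ I ∧ t.2.1 ∈ Uset q F ∧ t.2.2 ∈ Uset q F) ∧
  ∀ t ∈ G, ∀ t' ∈ G, t ≠ t' →
    t.2.1 * t'.2.2 - t'.2.1 * t.2.2 ≠ 0 ∧
    t.1 * t.2.1 * (t'.1 * t'.2.2) ^ q - (t.1 * t.2.2) ^ q * (t'.1 * t'.2.1) ≠ 0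

/-- `L_G = ⋃_{(α,u,v) ∈ G} ( p(P_{αu}, π_{αv}) \ {r_{U₁}} )`. -/
def Lset (G : Finset (F × F × F)) : Set (Set (Pt F)) :=
  ⋃ t ∈ G, (pencil q F t.1 t.2.1 t.2.2 \ {rU1 F})

/-- The putative parallelism `Π_G` associated with `G`. -/
def ParP (η : F) (G : Finset (F × F × F)) : Set (Set (Set (Pt F))) :=
  {S | ∃ ℓ ∈ Lset q F G, S = (Sspread q F η ℓ \ Rreg q F η ℓ) ∪ Ropp q F η ℓ}
    ∪ {Dspread q F η}

def gFun (b : F) (v : Fin 4 → F) : Fin 4 → F :=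
  ![v 0 + b * v 1, v 1, v 2 + b ^ q * v 3, v 3]

/-- The projectivity `g_b : (x₁,x₂,x₃,x₄) ↦ (x₁ + b x₂, x₂, x₃ + bᑫ x₄, x₄)`. -/
def gmap (b : F) (P : Pt F) : Pt F :=
  if h : gFun q F b P.rep ≠ 0 then Projectivization.mk F _ h else P

end

section FieldFacts

variable {q : ℕ} {F : Type} [Field F] [Fintype F]

lemma exists_ringHom_eq_pow (hq : IsPrimePow q) (hF : Fintype.card F = q ^ 2) :
    ∃ σ : F →+* F, ∀ x, σ x = x ^ q := by
  obtain ⟨p, k, hp, hk, rfl⟩ := hq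
  obtain ⟨p', hchar, n, hp', hn⟩ := FiniteField.card' F
  have h : p' ∣ p := by
    have : p' ∣ (p ^ k) ^ 2 := by rw [← hF, hn]; exact dvd_pow_self _ n.2.ne'
    exact hp'.dvd_of_dvd_pow (hp'.dvd_of_dvd_pow this)
  obtain rfl := (Nat.prime_dvd_prime_iff_eq hp' hp.nat_prime).1 h
  have : Fact p'.Prime := ⟨hp'⟩
  exact ⟨iterateFrobenius F p' k, fun x => iterateFrobenius_def p' k x⟩

lemma ncard_pow_eq_one {n : ℕ} (hn : 0 < n) (hdvd : n ∣ Fintype.card F - 1) :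
    {x : F | x ^ n = 1}.ncard = n := by
  obtain ⟨g, hg⟩ := IsCyclic.exists_ofOrder_eq_natCard (α := Fˣ)
  obtain ⟨m, hm⟩ := hdvd
  have hcard : Nat.card Fˣ = m * n := by
    rw [Nat.card_eq_fintype_card, Fintype.card_units, hm, mul_comm]
  have hg' : IsPrimitiveRoot (g : F) (m * n) := by
    rw [IsPrimitiveRoot.coe_units_iff, ← hcard, ← hg]
    exact IsPrimitiveRoot.orderOf g
  have hpos : 0 < m * n := by rw [← hcard]; exact Nat.card_pos
  have h := (hg'.pow hpos rfl).card_nthRootsFinset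
  rw [← Set.ncard_coe_finset] at h
  convert h using 2
  ext x
  simp [Polynomial.mem_nthRootsFinset hn]

lemma ncard_pow_eq_self (hq : 2 ≤ q) (hF : Fintype.card F = q ^ 2) :
    {x : F | x ^ q = x}.ncard = q := by
  have h : {x : F | x ^ q = x} = insert 0 {x : F | x ^ (q - 1) = 1} := by
    ext x
    obtain ⟨r, rfl⟩ : ∃ r, q = r + 2 := ⟨q - 2, by omega⟩
    simp only [Set.mem_ofPred_eq, Set.mem_insert_iff]
    by_cases hx : x = 0
    · simp [hx]
    · simp [hx, pow_succ]
  rw [h, Set.ncard_insert_of_notMem (by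
    simp only [Set.mem_ofPred_eq]; rw [zero_pow (by omega)]; simp), ncard_pow_eq_one (by omega)]
  · omega
  · rw [hF]
    exact ⟨q + 1, by rw [mul_comm, ← Nat.sq_sub_sq]⟩

lemma ncard_pow_add_one_eq_one (hq : 2 ≤ q) (hF : Fintype.card F = q ^ 2) :
    {x : F | x ^ (q + 1) = 1}.ncard = q + 1 := by
  refine ncard_pow_eq_one (by omega) ?_
  rw [hF]
  exact ⟨q - 1, by rw [← Nat.sq_sub_sq]⟩

end FieldFacts

section Conjugation

variable {q : ℕ} {F : Type} [Field F] {σ : F →+* F}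

/-- The semilinear involution whose fixed vectors represent the points of `Σ_α`. -/
def semiInv (σ : F →+* F) (α : F) (v : Fin 4 → F) : Fin 4 → F :=
  ![σ (v 2) / σ α, σ (v 3) / σ α, α * σ (v 0), α * σ (v 1)]

lemma vec4_ext {α : Type*} {v w : Fin 4 → α} (h0 : v 0 = w 0) (h1 : v 1 = w 1) (h2 : v 2 = w 2)
    (h3 : v 3 = w 3) : v = w := by
  ext i
  fin_cases i <;> assumption

lemma semiInv_add (α : F) (v w : Fin 4 → F) :
    semiInv σ α (v + w) = semiInv σ α v + semiInv σ α w := by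
  apply vec4_ext <;> simp [semiInv] <;> ring

lemma semiInv_smul (α c : F) (v : Fin 4 → F) :
    semiInv σ α (c • v) = σ c • semiInv σ α v := by
  apply vec4_ext <;> simp [semiInv] <;> ring

lemma semiInv_semiInv (hσ : ∀ x, σ (σ x) = x) {α : F} (hα : α ≠ 0) (v : Fin 4 → F) :
    semiInv σ α (semiInv σ α v) = v := by
  have : σ α ≠ 0 := by simpa using hα
  apply vec4_ext <;> simp [semiInv, hσ] <;> field_simp

lemma semiInv_zero (α : F) : semiInv σ α 0 = 0 := by
  simpa using semiInv_smul (σ := σ) α 0 0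

lemma semiInv_ne_zero (hσ : ∀ x, σ (σ x) = x) {α : F} (hα : α ≠ 0) {v : Fin 4 → F}
    (hv : v ≠ 0) : semiInv σ α v ≠ 0 := by
  intro h
  apply hv
  rw [← semiInv_semiInv hσ hα v, h, semiInv_zero]

/-- The point set of the projective subspace attached to `W`. -/
def pts (W : Submodule F (Fin 4 → F)) : Set (Pt F) := {P | P.submodule ≤ W}

lemma mk_mem_pts {W : Submodule F (Fin 4 → F)} {v : Fin 4 → F} (hv : v ≠ 0) :
    Projectivization.mk F v hv ∈ pts W ↔ v ∈ W := by
  simp [pts, Projectivization.submodule_mk, Submodule.span_singleton_le_iff_mem]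

lemma pts_injective : Function.Injective (pts (F := F)) := by
  intro W W' h
  ext v
  by_cases hv : v = 0
  · simp [hv]
  · rw [← mk_mem_pts hv, h, mk_mem_pts]

lemma lineThrough_mk {x y : Fin 4 → F} (hx : x ≠ 0) (hy : y ≠ 0) :
    lineThrough F (Projectivization.mk F x hx) (Projectivization.mk F y hy) =
      pts (Submodule.span F {x, y}) := by
  simp only [lineThrough, pts, Projectivization.submodule_mk]
  rw [Submodule.span_insert]

lemma mem_SigmaSet_iff (hq : ∀ x, σ x = x ^ q) (hσ : ∀ x, σ (σ x) = x) {α : F} (hα : α ≠ 0)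
    (P : Pt F) : P ∈ SigmaSet q F α ↔
      ∃ (v : Fin 4 → F) (hv : v ≠ 0), semiInv σ α v = v ∧ P = Projectivization.mk F v hv := by
  have hα' : σ α ≠ 0 := by simpa using hα
  constructor
  · rintro ⟨x, y, h, rfl⟩
    refine ⟨_, h, ?_, rfl⟩
    apply vec4_ext <;> simp [semiInv, ← hq, hσ] <;> field_simp
  · rintro ⟨v, hv, h, rfl⟩
    have h2 : α * σ (v 0) = v 2 := by simpa [semiInv] using congrFun h 2
    have h3 : α * σ (v 1) = v 3 := by simpa [semiInv] using congrFun h 3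
    have hv' : v = ![v 0, v 1, α * v 0 ^ q, α * v 1 ^ q] := by
      apply vec4_ext <;> simp [← hq, h2, h3]
    exact ⟨v 0, v 1, hv' ▸ hv, by congr 1⟩

/-- A point fixed by the involution has a fixed representative vector. -/
lemma exists_fixed_smul (hσ : ∀ x, σ (σ x) = x) (hne : ∃ c, σ c ≠ c) {α : F} (hα : α ≠ 0)
    {v : Fin 4 → F} (hv : v ≠ 0) {k : F} (h : semiInv σ α v = k • v) :
    ∃ c : F, c ≠ 0 ∧ semiInv σ α (c • v) = c • v := by
  have hk : σ k * k = 1 := by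
    have h1 := semiInv_semiInv hσ hα v
    rw [h, semiInv_smul, h, smul_smul] at h1
    by_contra hne
    apply hv
    have : (σ k * k - 1) • v = 0 := by rw [sub_smul, h1, one_smul, sub_self]
    exact (smul_eq_zero.1 this).resolve_left (sub_ne_zero.2 hne)
  by_cases hk1 : k = -1
  · obtain ⟨c, hc⟩ := hne
    refine ⟨c - σ c, sub_ne_zero.2 hc.symm, ?_⟩
    rw [semiInv_smul, h, hk1, smul_smul, map_sub, hσ]
    congr 1; ring
  · refine ⟨1 + k, fun h => hk1 (by linear_combination h), ?_⟩
    rw [semiInv_smul, h, smul_smul, map_add, map_one]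
    congr 1; linear_combination hk

lemma mk_mem_SigmaSet_iff (hq : ∀ x, σ x = x ^ q) (hσ : ∀ x, σ (σ x) = x)
    (hne : ∃ c, σ c ≠ c) {α : F} (hα : α ≠ 0) {v : Fin 4 → F} (hv : v ≠ 0) :
    Projectivization.mk F v hv ∈ SigmaSet q F α ↔ ∃ k : F, semiInv σ α v = k • v := by
  rw [mem_SigmaSet_iff hq hσ hα]
  constructor
  · rintro ⟨w, hw, h, hP⟩
    obtain ⟨a, rfl⟩ := (Projectivization.mk_eq_mk_iff' F _ _ _ _).1 hP
    have ha : a ≠ 0 := by rintro rfl; simp at hv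
    refine ⟨σ a / a, ?_⟩
    rw [semiInv_smul, h, smul_smul, div_mul_cancel₀ _ ha]
  · rintro ⟨k, h⟩
    obtain ⟨c, hc, h'⟩ := exists_fixed_smul hσ hne hα hv h
    refine ⟨c • v, smul_ne_zero hc hv, h', ?_⟩
    rw [Projectivization.mk_eq_mk_iff']
    exact ⟨c⁻¹, by rw [smul_smul, inv_mul_cancel₀ hc, one_smul]⟩

lemma fixed_mem_SigmaSet (hq : ∀ x, σ x = x ^ q) (hσ : ∀ x, σ (σ x) = x)
    {α : F} (hα : α ≠ 0) {v : Fin 4 → F} (hv : v ≠ 0) (h : semiInv σ α v = v) :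
    Projectivization.mk F v hv ∈ SigmaSet q F α :=
  (mem_SigmaSet_iff hq hσ hα _).2 ⟨v, hv, h, rfl⟩

lemma tau_mk (hq : ∀ x, σ x = x ^ q) (hσ : ∀ x, σ (σ x) = x) {η : F} (hη : η ^ (q + 1) = 1)
    {v : Fin 4 → F} (hv : v ≠ 0) (hv' : semiInv σ η v ≠ 0) :
    tau q F η (Projectivization.mk F v hv) = Projectivization.mk F (semiInv σ η v) hv' := by
  have hη0 : η ≠ 0 := by rintro rfl; simp at hη
  have hση : σ η ≠ 0 := by simpa using hη0
  have hη1 : η * σ η = 1 := by rw [hq, ← hη, pow_succ']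
  have hfun : ∀ w : Fin 4 → F, semiInv σ η w = η • tauFun q F η w := by
    intro w
    apply vec4_ext <;> simp [semiInv, tauFun, hη, ← hq, div_eq_iff hση]
    · linear_combination -σ (w 2) * hη1
    · linear_combination -σ (w 3) * hη1
  obtain ⟨a, ha⟩ := Projectivization.exists_smul_eq_mk_rep F v hv
  have hrep : tauFun q F η (Projectivization.mk F v hv).rep ≠ 0 := by
    intro h0
    apply semiInv_ne_zero hσ hη0 (Projectivization.rep_nonzero (Projectivization.mk F v hv))
    rw [hfun, h0, smul_zero]
  rw [tau, dif_pos hrep, Projectivization.mk_eq_mk_iff']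
  have ha0 : σ (a : F) ≠ 0 := by simp
  refine ⟨η⁻¹ * σ a, ?_⟩
  rw [← smul_smul, ← semiInv_smul]
  have : (a : F) • v = (Projectivization.mk F v hv).rep := ha
  rw [this, hfun, smul_smul, inv_mul_cancel₀ hη0, one_smul]
end Conjugation

section Lines

variable {q : ℕ} {F : Type} [Field F] {σ : F →+* F}

lemma finrank_span_pair {x y : Fin 4 → F} (h : LinearIndependent F ![x, y]) :
    Module.finrank F (Submodule.span F {x, y}) = 2 := by
  have := finrank_span_eq_card h
  rwa [Matrix.range_cons_cons_empty, Fintype.card_fin] at this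

lemma eq_span_pair {W : Submodule F (Fin 4 → F)} (hW : Module.finrank F W = 2)
    {x y : Fin 4 → F} (hx : x ∈ W) (hy : y ∈ W) (h : LinearIndependent F ![x, y]) :
    W = Submodule.span F {x, y} := by
  refine (Submodule.eq_of_le_of_finrank_eq ?_ ?_).symm
  · rw [Submodule.span_le]
    rintro z (rfl | rfl) <;> assumption
  · rw [finrank_span_pair h, hW]

lemma exists_linearIndependent_pair {W : Submodule F (Fin 4 → F)} (hW : Module.finrank F W = 2) :
    ∃ x y, LinearIndependent F ![x, y] ∧ W = Submodule.span F {x, y} := by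
  let b := Module.finBasisOfFinrankEq F W hW
  have hb : LinearIndependent F ![(b 0 : Fin 4 → F), (b 1 : Fin 4 → F)] := by
    have h := b.linearIndependent.map' W.subtype (Submodule.ker_subtype W)
    have hfun : ![(b 0 : Fin 4 → F), (b 1 : Fin 4 → F)] = W.subtype ∘ b := by
      ext i j
      fin_cases i <;> rfl
    rw [hfun]
    exact h
  exact ⟨b 0, b 1, hb, eq_span_pair hW (b 0).2 (b 1).2 hb⟩

lemma isLine_pts_span_pair {x y : Fin 4 → F} (h : LinearIndependent F ![x, y]) :
    isLine F (pts (Submodule.span F {x, y})) :=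
  ⟨_, finrank_span_pair h, rfl⟩

lemma linearIndependent_of_mk_ne {x y : Fin 4 → F} (hx : x ≠ 0) (hy : y ≠ 0)
    (h : Projectivization.mk F x hx ≠ Projectivization.mk F y hy) :
    LinearIndependent F ![x, y] := by
  rw [LinearIndependent.pair_iff' hx]
  intro a ha
  exact h.symm ((Projectivization.mk_eq_mk_iff' F _ _ _ _).2 ⟨a, ha⟩)

lemma semiInv_mem_span {α : F} {x y v : Fin 4 → F} (hx : semiInv σ α x = x)
    (hy : semiInv σ α y = y) (hv : v ∈ Submodule.span F {x, y}) :
    semiInv σ α v ∈ Submodule.span F {x, y} := by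
  obtain ⟨a, b, rfl⟩ := Submodule.mem_span_pair.1 hv
  rw [semiInv_add, semiInv_smul, semiInv_smul, hx, hy]
  exact Submodule.mem_span_pair.2 ⟨_, _, rfl⟩

/-- A line spanned by two points of `Σ_α` meets `Σ_α` in exactly `q + 1` points. -/
lemma ncard_pts_inter_SigmaSet [Fintype F] (hq2 : 2 ≤ q) (hF : Fintype.card F = q ^ 2)
    (hq : ∀ x, σ x = x ^ q) (hσ : ∀ x, σ (σ x) = x) {α : F} (hα : α ≠ 0)
    {x y : Fin 4 → F} (hx : semiInv σ α x = x) (hy : semiInv σ α y = y)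
    (h : LinearIndependent F ![x, y]) :
    (pts (Submodule.span F {x, y}) ∩ SigmaSet q F α).ncard = q + 1 := by
  have hli := LinearIndependent.pair_iff.1 h
  have hy0 : y ≠ 0 := by
    rintro rfl
    simpa using hli 0 1
  have hne : ∀ b : F, x + b • y ≠ 0 := by
    intro b hb
    simpa using (hli 1 b (by simpa using hb)).1
  have hset : pts (Submodule.span F {x, y}) ∩ SigmaSet q F α =
      insert (Projectivization.mk F y hy0)
        ((fun b : F => Projectivization.mk F (x + b • y) (hne b)) '' {b : F | b ^ q = b}) := by
    ext P
    constructor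
    · rintro ⟨hP, hS⟩
      obtain ⟨v, hv, hfix, rfl⟩ := (mem_SigmaSet_iff hq hσ hα P).1 hS
      obtain ⟨a, b, rfl⟩ := Submodule.mem_span_pair.1 ((mk_mem_pts hv).1 hP)
      rw [semiInv_add, semiInv_smul, semiInv_smul, hx, hy] at hfix
      have hab := hli (σ a - a) (σ b - b) (by
        rw [sub_smul, sub_smul, ← sub_eq_zero.2 hfix]; abel)
      by_cases ha : a = 0
      · left
        rw [Projectivization.mk_eq_mk_iff']
        exact ⟨b, by simp [ha]⟩
      · right
        refine ⟨b / a, ?_, ?_⟩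
        · change (b / a) ^ q = b / a
          rw [← hq, map_div₀, sub_eq_zero.1 hab.1, sub_eq_zero.1 hab.2]
        · rw [Projectivization.mk_eq_mk_iff']
          refine ⟨a⁻¹, ?_⟩
          rw [smul_add, smul_smul, smul_smul, inv_mul_cancel₀ ha, one_smul, div_eq_inv_mul]
    · rintro (rfl | ⟨b, hb, rfl⟩)
      · exact ⟨(mk_mem_pts hy0).2 (Submodule.subset_span (by simp)),
          fixed_mem_SigmaSet hq hσ hα hy0 hy⟩
      · refine ⟨(mk_mem_pts _).2 (Submodule.mem_span_pair.2 ⟨1, b, by simp⟩),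
          fixed_mem_SigmaSet hq hσ hα _ ?_⟩
        rw [semiInv_add, semiInv_smul, hx, hy, hq b, hb.out]
  rw [hset, Set.ncard_insert_of_notMem _ (Set.toFinite _), Set.ncard_image_of_injective,
    ncard_pow_eq_self hq2 hF]
  · intro b b' hbb
    obtain ⟨a, ha⟩ := (Projectivization.mk_eq_mk_iff' F _ _ _ _).1 hbb
    have := hli (a - 1) (a * b' - b) (by
      rw [← sub_eq_zero.2 ha, sub_smul, sub_smul, smul_add, smul_smul, one_smul]; abel)
    have h1 := sub_eq_zero.1 this.1
    have h2 := sub_eq_zero.1 this.2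
    rw [h1, one_mul] at h2
    exact h2.symm
  · rintro ⟨b, -, hb⟩
    obtain ⟨a, ha⟩ := (Projectivization.mk_eq_mk_iff' F _ _ _ _).1 hb
    have := hli 1 (b - a) (by rw [← sub_eq_zero.2 ha.symm, sub_smul, one_smul]; abel)
    simpa using this.1

lemma isLineOfSigma_pts [Fintype F] (hq2 : 2 ≤ q) (hF : Fintype.card F = q ^ 2)
    (hq : ∀ x, σ x = x ^ q) (hσ : ∀ x, σ (σ x) = x) {α : F} (hα : α ≠ 0)
    {x y : Fin 4 → F} (hx : semiInv σ α x = x) (hy : semiInv σ α y = y)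
    (h : LinearIndependent F ![x, y]) :
    IsLineOfSigma q F α (pts (Submodule.span F {x, y}) ∩ SigmaSet q F α) :=
  ⟨_, isLine_pts_span_pair h, rfl, ncard_pts_inter_SigmaSet hq2 hF hq hσ hα hx hy h⟩

lemma exists_fixed_pair (hq2 : 2 ≤ q) (hq : ∀ x, σ x = x ^ q) (hσ : ∀ x, σ (σ x) = x)
    {α : F} (hα : α ≠ 0) {W : Submodule F (Fin 4 → F)} (hW : Module.finrank F W = 2)
    (hcard : (pts W ∩ SigmaSet q F α).ncard = q + 1) :
    ∃ x y, semiInv σ α x = x ∧ semiInv σ α y = y ∧ LinearIndependent F ![x, y] ∧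
      W = Submodule.span F {x, y} := by
  have hfin : (pts W ∩ SigmaSet q F α).Finite := Set.finite_of_ncard_pos (by omega)
  obtain ⟨P, Q, hP, hQ, hPQ⟩ := (Set.one_lt_ncard_iff hfin).1 (by omega)
  obtain ⟨x, hx, hxf, rfl⟩ := (mem_SigmaSet_iff hq hσ hα P).1 hP.2
  obtain ⟨y, hy, hyf, rfl⟩ := (mem_SigmaSet_iff hq hσ hα Q).1 hQ.2
  have hli := linearIndependent_of_mk_ne hx hy hPQ
  exact ⟨x, y, hxf, hyf, hli,
    eq_span_pair hW ((mk_mem_pts hx).1 hP.1) ((mk_mem_pts hy).1 hQ.1) hli⟩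

lemma IsLineOfSigma.exists_fixed_pair (hq2 : 2 ≤ q) (hq : ∀ x, σ x = x ^ q)
    (hσ : ∀ x, σ (σ x) = x) {α : F} (hα : α ≠ 0) {m : Set (Pt F)}
    (hm : IsLineOfSigma q F α m) :
    ∃ x y, semiInv σ α x = x ∧ semiInv σ α y = y ∧ LinearIndependent F ![x, y] ∧
      m = pts (Submodule.span F {x, y}) ∩ SigmaSet q F α := by
  obtain ⟨s, ⟨W, hW, rfl⟩, rfl, hcard⟩ := hm
  obtain ⟨x, y, hx, hy, hli, hWs⟩ := _root_.exists_fixed_pair hq2 hq hσ hα hW hcard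
  exact ⟨x, y, hx, hy, hli, by rw [← hWs]; rfl⟩

lemma span_le_of_inter_subset (hq : ∀ x, σ x = x ^ q) (hσ : ∀ x, σ (σ x) = x)
    {α : F} (hα : α ≠ 0) {x y : Fin 4 → F} (hx : semiInv σ α x = x) (hy : semiInv σ α y = y)
    {W : Submodule F (Fin 4 → F)}
    (h : pts (Submodule.span F {x, y}) ∩ SigmaSet q F α ⊆ pts W) :
    Submodule.span F {x, y} ≤ W := by
  have key : ∀ z ∈ ({x, y} : Set (Fin 4 → F)), semiInv σ α z = z → z ∈ W := by
    intro z hz hfix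
    by_cases hz0 : z = 0
    · rw [hz0]; exact W.zero_mem
    · exact (mk_mem_pts hz0).1 (h ⟨(mk_mem_pts hz0).2 (Submodule.subset_span hz),
        fixed_mem_SigmaSet hq hσ hα hz0 hfix⟩)
  rw [Submodule.span_le]
  rintro z (rfl | rfl)
  · exact key _ (by simp) hx
  · exact key _ (by simp) hy

lemma exists_fixed_pair_of_semiInv (hσ : ∀ x, σ (σ x) = x) (hne : ∃ c, σ c ≠ c) {α : F}
    (hα : α ≠ 0) {w : Fin 4 → F} (h : LinearIndependent F ![w, semiInv σ α w]) :
    ∃ x y, semiInv σ α x = x ∧ semiInv σ α y = y ∧ LinearIndependent F ![x, y] ∧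
      Submodule.span F {w, semiInv σ α w} = Submodule.span F {x, y} := by
  obtain ⟨c, hc⟩ := hne
  have hli := LinearIndependent.pair_iff.1 h
  have hxy : LinearIndependent F ![w + semiInv σ α w, c • w + σ c • semiInv σ α w] := by
    rw [LinearIndependent.pair_iff]
    intro s t hst
    have := hli (s + t * c) (s + t * σ c) (by
      rw [← hst]; simp only [smul_add, smul_smul, add_smul]; abel)
    have ht : t * (σ c - c) = 0 := by linear_combination this.2 - this.1
    have ht0 : t = 0 := (mul_eq_zero.1 ht).resolve_right (sub_ne_zero.2 hc)
    refine ⟨?_, ht0⟩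
    simpa [ht0] using this.1
  refine ⟨w + semiInv σ α w, c • w + σ c • semiInv σ α w, ?_, ?_, hxy, ?_⟩
  · rw [semiInv_add, semiInv_semiInv hσ hα, add_comm]
  · rw [semiInv_add, semiInv_smul, semiInv_smul, semiInv_semiInv hσ hα, hσ, add_comm]
  · exact eq_span_pair (finrank_span_pair h) (Submodule.mem_span_pair.2 ⟨1, 1, by simp⟩)
      (Submodule.mem_span_pair.2 ⟨c, σ c, rfl⟩) hxy

lemma disjoint_of_inter_eq_empty (hq : ∀ x, σ x = x ^ q) (hσ : ∀ x, σ (σ x) = x)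
    (hne : ∃ c, σ c ≠ c) {α : F} (hα : α ≠ 0) {W W' : Submodule F (Fin 4 → F)}
    (hW : ∀ v ∈ W, semiInv σ α v ∈ W) (hW' : ∀ v ∈ W', semiInv σ α v ∈ W')
    (h : (pts W ∩ SigmaSet q F α) ∩ (pts W' ∩ SigmaSet q F α) = ∅) : Disjoint W W' := by
  rw [Submodule.disjoint_def]
  intro v hv hv'
  obtain ⟨c, hc⟩ := hne
  have key : ∀ z, z ∈ W → z ∈ W' → semiInv σ α z = z → z = 0 := by
    intro z hz hz' hfix
    by_contra hz0
    have hS := fixed_mem_SigmaSet hq hσ hα hz0 hfix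
    have : Projectivization.mk F z hz0 ∈
        (pts W ∩ SigmaSet q F α) ∩ (pts W' ∩ SigmaSet q F α) :=
      ⟨⟨(mk_mem_pts hz0).2 hz, hS⟩, ⟨(mk_mem_pts hz0).2 hz', hS⟩⟩
    rw [h] at this
    exact this
  have h1 := key (v + semiInv σ α v) (W.add_mem hv (hW v hv)) (W'.add_mem hv' (hW' v hv'))
    (by rw [semiInv_add, semiInv_semiInv hσ hα, add_comm])
  have h2 := key (c • v + σ c • semiInv σ α v)
    (W.add_mem (W.smul_mem _ hv) (W.smul_mem _ (hW v hv)))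
    (W'.add_mem (W'.smul_mem _ hv') (W'.smul_mem _ (hW' v hv')))
    (by rw [semiInv_add, semiInv_smul, semiInv_smul, semiInv_semiInv hσ hα, hσ, add_comm])
  have h3 : (c - σ c) • v = 0 := by
    have : (c - σ c) • v = (c • v + σ c • semiInv σ α v) - σ c • (v + semiInv σ α v) := by
      rw [sub_smul, smul_add]; abel
    rw [this, h1, h2, smul_zero, sub_zero]
  exact (smul_eq_zero.1 h3).resolve_left (sub_ne_zero.2 hc.symm)

lemma exists_add_eq_of_disjoint {W W' : Submodule F (Fin 4 → F)} (hW : Module.finrank F W = 2)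
    (hW' : Module.finrank F W' = 2) (h : Disjoint W W') (v : Fin 4 → F) :
    ∃ w ∈ W, ∃ w' ∈ W', w + w' = v := by
  have hsup : W ⊔ W' = ⊤ := by
    apply Submodule.eq_top_of_finrank_eq
    have := Submodule.finrank_sup_add_finrank_inf_eq W W'
    rw [h.eq_bot, finrank_bot, hW, hW'] at this
    simpa using this
  exact Submodule.mem_sup.1 (hsup ▸ Submodule.mem_top : v ∈ W ⊔ W')

lemma eq_of_add_eq_add {W W' : Submodule F (Fin 4 → F)} (h : Disjoint W W')
    {a b a' b' : Fin 4 → F} (ha : a ∈ W) (hb : b ∈ W) (ha' : a' ∈ W') (hb' : b' ∈ W')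
    (hab : a + a' = b + b') : a = b ∧ a' = b' := by
  have h1 : a - b = b' - a' := by
    rw [sub_eq_sub_iff_add_eq_add, hab, add_comm]
  have h0 : a - b = 0 := Submodule.disjoint_def.1 h _ (W.sub_mem ha hb)
    (h1 ▸ W'.sub_mem hb' ha')
  exact ⟨sub_eq_zero.1 h0, (sub_eq_zero.1 (h1 ▸ h0)).symm⟩

/-- Through each point of a line of `Σ_α` there is a transversal to two further lines of `Σ_α`
when the three lines are pairwise disjoint. -/
lemma exists_transversal [Fintype F] (hq2 : 2 ≤ q) (hF : Fintype.card F = q ^ 2)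
    (hq : ∀ x, σ x = x ^ q) (hσ : ∀ x, σ (σ x) = x) (hne : ∃ c, σ c ≠ c) {α : F} (hα : α ≠ 0)
    {m1 m2 m3 : Set (Pt F)} (h1 : IsLineOfSigma q F α m1) (h2 : IsLineOfSigma q F α m2)
    (h3 : IsLineOfSigma q F α m3) (h12 : m1 ∩ m2 = ∅) (h13 : m1 ∩ m3 = ∅) (h23 : m2 ∩ m3 = ∅)
    {P : Pt F} (hP : P ∈ m1) :
    ∃ m, IsLineOfSigma q F α m ∧ P ∈ m ∧ (m ∩ m2).Nonempty ∧ (m ∩ m3).Nonempty := by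
  have hPS : P ∈ SigmaSet q F α := by
    obtain ⟨s, -, rfl, -⟩ := h1
    exact hP.2
  obtain ⟨x, y, hx, hy, hxy, rfl⟩ := h2.exists_fixed_pair hq2 hq hσ hα
  obtain ⟨z, w, hz, hw, hzw, rfl⟩ := h3.exists_fixed_pair hq2 hq hσ hα
  have hdis := disjoint_of_inter_eq_empty hq hσ hne hα
    (fun v hv => semiInv_mem_span hx hy hv) (fun v hv => semiInv_mem_span hz hw hv) h23
  obtain ⟨p, hp, hpf, rfl⟩ := (mem_SigmaSet_iff hq hσ hα P).1 hPS
  obtain ⟨a, ha, b, hb, hab⟩ := exists_add_eq_of_disjoint (finrank_span_pair hxy)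
    (finrank_span_pair hzw) hdis p
  obtain ⟨haf, hbf⟩ := eq_of_add_eq_add hdis (semiInv_mem_span hx hy ha) ha
    (semiInv_mem_span hz hw hb) hb (by rw [← semiInv_add, hab, hpf])
  have ha0 : a ≠ 0 := by
    rintro rfl
    rw [zero_add] at hab
    subst hab
    exact h13.subset ⟨hP, (mk_mem_pts hp).2 hb, hPS⟩
  have hb0 : b ≠ 0 := by
    rintro rfl
    rw [add_zero] at hab
    subst hab
    exact h12.subset ⟨hP, (mk_mem_pts hp).2 ha, hPS⟩
  have hli : LinearIndependent F ![a, b] := by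
    rw [LinearIndependent.pair_iff' ha0]
    rintro c rfl
    exact hb0 (Submodule.disjoint_def.1 hdis _ (Submodule.smul_mem _ _ ha) hb)
  refine ⟨_, isLineOfSigma_pts hq2 hF hq hσ hα haf hbf hli,
    ⟨(mk_mem_pts hp).2 (Submodule.mem_span_pair.2 ⟨1, 1, by simpa using hab⟩), hPS⟩,
    ⟨Projectivization.mk F a ha0, ?_⟩, ⟨Projectivization.mk F b hb0, ?_⟩⟩
  · have hS := fixed_mem_SigmaSet hq hσ hα ha0 haf
    exact ⟨⟨(mk_mem_pts ha0).2 (Submodule.subset_span (by simp)), hS⟩, (mk_mem_pts ha0).2 ha, hS⟩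
  · have hS := fixed_mem_SigmaSet hq hσ hα hb0 hbf
    exact ⟨⟨(mk_mem_pts hb0).2 (Submodule.subset_span (by simp)), hS⟩, (mk_mem_pts hb0).2 hb, hS⟩

end Lines

section Spreads

variable {q : ℕ} {F : Type} [Field F] {σ : F →+* F}

/-- The subspace spanned by `(a, b, 0, 0)` and `(0, 0, aᑫ, bᑫ)`. -/
def rSub (σ : F →+* F) (a b : F) : Submodule F (Fin 4 → F) :=
  Submodule.span F {![a, b, 0, 0], ![0, 0, σ a, σ b]}

lemma mem_rSub {a b : F} {v : Fin 4 → F} :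
    v ∈ rSub σ a b ↔ ∃ s t : F, v = ![s * a, s * b, t * σ a, t * σ b] := by
  rw [rSub, Submodule.mem_span_pair]
  simp [eq_comm]

lemma linearIndependent_rSub {a b : F} (h : a ≠ 0 ∨ b ≠ 0) {c : F} (hc : c ≠ 0) :
    LinearIndependent F ![![a, b, 0, 0], c • ![0, 0, σ a, σ b]] := by
  rw [LinearIndependent.pair_iff]
  intro s t hst
  have h0 := congrFun hst 0
  have h1 := congrFun hst 1
  have h2 := congrFun hst 2
  have h3 := congrFun hst 3
  simp at h0 h1 h2 h3
  tauto

lemma finrank_rSub {a b : F} (h : a ≠ 0 ∨ b ≠ 0) : Module.finrank F (rSub σ a b) = 2 := by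
  have := linearIndependent_rSub (σ := σ) h one_ne_zero
  rw [one_smul] at this
  exact finrank_span_pair this

lemma rSub_smul {a b c : F} (hc : c ≠ 0) : rSub σ (c * a) (c * b) = rSub σ a b := by
  have hσc : σ c ≠ 0 := by simpa using hc
  ext v
  simp only [mem_rSub]
  constructor
  · rintro ⟨s, t, rfl⟩
    exact ⟨s * c, t * σ c, by simp [mul_assoc]⟩
  · rintro ⟨s, t, rfl⟩
    refine ⟨s / c, t / σ c, ?_⟩
    apply vec4_ext <;> simp <;> field_simp

lemma cross_eq_of_mem_rSub {a b a' b' : F} (h : a ≠ 0 ∨ b ≠ 0) {v : Fin 4 → F} (hv : v ≠ 0)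
    (hm : v ∈ rSub σ a b) (hm' : v ∈ rSub σ a' b') : a * b' = a' * b := by
  obtain ⟨s, t, rfl⟩ := mem_rSub.1 hm
  obtain ⟨s', t', heq⟩ := mem_rSub.1 hm'
  have e0 := congrFun heq 0
  have e1 := congrFun heq 1
  have e2 := congrFun heq 2
  have e3 := congrFun heq 3
  simp at e0 e1 e2 e3
  by_cases hs : s = 0
  · have ht : t ≠ 0 := by
      rintro rfl
      exact hv (by simp [hs])
    have hinj : σ (a * b') = σ (a' * b) := by
      rw [map_mul, map_mul]
      by_cases ht' : t' = 0
      · simp [ht', ht] at e2 e3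
        tauto
      · apply mul_left_cancel₀ (mul_ne_zero ht ht')
        linear_combination e2 * (t' * σ b') - e3 * (t' * σ a')
    exact σ.injective hinj
  · by_cases hs' : s' = 0
    · simp [hs', hs] at e0 e1
      tauto
    · apply mul_left_cancel₀ (mul_ne_zero hs hs')
      linear_combination e0 * (s' * b') - e1 * (s' * a')

lemma semiInv_fst (α a b : F) :
    semiInv σ α ![a, b, 0, 0] = α • ![0, 0, σ a, σ b] := by
  apply vec4_ext <;> simp [semiInv]

lemma semiInv_mem_rSub {α a b : F} {v : Fin 4 → F} (hv : v ∈ rSub σ a b)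
    (hσ : ∀ x, σ (σ x) = x) : semiInv σ α v ∈ rSub σ a b := by
  obtain ⟨s, t, rfl⟩ := mem_rSub.1 hv
  refine mem_rSub.2 ⟨σ t / σ α, α * σ s, ?_⟩
  apply vec4_ext <;> simp [semiInv, hσ] <;> ring

lemma mk_mem_t1 {a b : F} (h : ![a, b, 0, 0] ≠ 0) :
    Projectivization.mk F ![a, b, 0, 0] h ∈ t1 F := by
  obtain ⟨c, hc⟩ := Projectivization.exists_smul_eq_mk_rep F _ h
  constructor <;> rw [← hc] <;> simp

lemma vec_fst_ne_zero {a b : F} (h : a ≠ 0 ∨ b ≠ 0) : ![a, b, 0, 0] ≠ 0 := by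
  intro h0
  have e0 := congrFun h0 0
  have e1 := congrFun h0 1
  simp at e0 e1
  tauto

lemma rLine_mk (hq : ∀ x, σ x = x ^ q) (hσ : ∀ x, σ (σ x) = x) {a b : F}
    (h : ![a, b, 0, 0] ≠ 0) :
    rLine q F (Projectivization.mk F ![a, b, 0, 0] h) = pts (rSub σ a b) := by
  rw [rLine, tau_mk hq hσ (one_pow _) h (semiInv_ne_zero hσ one_ne_zero h), lineThrough_mk, rSub]
  simp only [semiInv_fst, one_smul]

lemma mem_Dspread_iff (hq : ∀ x, σ x = x ^ q) (hσ : ∀ x, σ (σ x) = x) {α : F}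
    {m : Set (Pt F)} : m ∈ Dspread q F α ↔
      ∃ a b : F, (a ≠ 0 ∨ b ≠ 0) ∧ m = pts (rSub σ a b) ∩ SigmaSet q F α := by
  constructor
  · rintro ⟨P, ⟨h2, h3⟩, rfl⟩
    have hrep : P.rep = ![P.rep 0, P.rep 1, 0, 0] := by
      apply vec4_ext <;> simp [h2, h3]
    have hne : ![P.rep 0, P.rep 1, 0, 0] ≠ 0 := hrep ▸ P.rep_nonzero
    have hP : P = Projectivization.mk F _ hne := by
      conv_lhs => rw [← P.mk_rep]
      congr 1
    refine ⟨P.rep 0, P.rep 1, ?_, ?_⟩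
    · by_contra! h
      exact hne (by simp [h.1, h.2])
    · rw [← rLine_mk hq hσ hne, ← hP]
  · rintro ⟨a, b, h, rfl⟩
    exact ⟨_, mk_mem_t1 (vec_fst_ne_zero h), by rw [rLine_mk hq hσ]⟩

lemma rU1_eq_pts : rU1 F = pts (rSub σ 1 0) := by
  ext P
  conv_rhs => rw [← P.mk_rep, mk_mem_pts, mem_rSub]
  constructor
  · rintro ⟨h1, h3⟩
    exact ⟨P.rep 0, P.rep 2, by apply vec4_ext <;> simp [h1, h3]⟩
  · rintro ⟨s, t, h⟩
    exact ⟨by simpa using congrFun h 1, by simpa using congrFun h 3⟩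

lemma exists_fixed_pair_rSub (hσ : ∀ x, σ (σ x) = x) (hne : ∃ c, σ c ≠ c) {α : F} (hα : α ≠ 0)
    {a b : F} (h : a ≠ 0 ∨ b ≠ 0) :
    ∃ x y, semiInv σ α x = x ∧ semiInv σ α y = y ∧ LinearIndependent F ![x, y] ∧
      rSub σ a b = Submodule.span F {x, y} := by
  have hli : LinearIndependent F ![![a, b, 0, 0], semiInv σ α ![a, b, 0, 0]] := by
    rw [semiInv_fst]
    exact linearIndependent_rSub h hα
  obtain ⟨x, y, hx, hy, hxy, hs⟩ := exists_fixed_pair_of_semiInv hσ hne hα hli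
  have hmem : ![a, b, 0, 0] ∈ rSub σ a b := Submodule.subset_span (by simp)
  exact ⟨x, y, hx, hy, hxy,
    hs ▸ eq_span_pair (finrank_rSub h) hmem (semiInv_mem_rSub hmem hσ) hli⟩

lemma isLineOfSigma_rSub [Fintype F] (hq2 : 2 ≤ q) (hF : Fintype.card F = q ^ 2)
    (hq : ∀ x, σ x = x ^ q) (hσ : ∀ x, σ (σ x) = x) (hne : ∃ c, σ c ≠ c) {α : F} (hα : α ≠ 0)
    {a b : F} (h : a ≠ 0 ∨ b ≠ 0) :
    IsLineOfSigma q F α (pts (rSub σ a b) ∩ SigmaSet q F α) := by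
  obtain ⟨x, y, hx, hy, hxy, hs⟩ := exists_fixed_pair_rSub hσ hne hα h
  rw [hs]
  exact isLineOfSigma_pts hq2 hF hq hσ hα hx hy hxy

section Sspread

variable {η : F} {W : Submodule F (Fin 4 → F)}

lemma linearIndependent_semiInv (hW : ∀ w ∈ W, w ≠ 0 → semiInv σ η w ∉ W) {w : Fin 4 → F}
    (hw : w ∈ W) (hw0 : w ≠ 0) : LinearIndependent F ![w, semiInv σ η w] := by
  rw [LinearIndependent.pair_iff' hw0]
  intro a ha
  exact hW w hw hw0 (ha ▸ W.smul_mem a hw)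

lemma mem_Sspread_iff (hq : ∀ x, σ x = x ^ q) (hσ : ∀ x, σ (σ x) = x)
    (hη : η ^ (q + 1) = 1) {m : Set (Pt F)} :
    m ∈ Sspread q F η (pts W) ↔ ∃ w ∈ W, w ≠ 0 ∧
      m = pts (Submodule.span F {w, semiInv σ η w}) ∩ SigmaSet q F η := by
  have hη0 : η ≠ 0 := by rintro rfl; simp at hη
  constructor
  · rintro ⟨Q, hQ, rfl⟩
    induction Q using Projectivization.ind with
    | h w hw =>
      refine ⟨w, (mk_mem_pts hw).1 hQ, hw, ?_⟩
      rw [tau_mk hq hσ hη hw (semiInv_ne_zero hσ hη0 hw), lineThrough_mk]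
  · rintro ⟨w, hw, hw0, rfl⟩
    refine ⟨_, (mk_mem_pts hw0).2 hw, ?_⟩
    rw [tau_mk hq hσ hη hw0 (semiInv_ne_zero hσ hη0 hw0), lineThrough_mk]

lemma pts_inter_image_tau_eq_empty_iff (hq : ∀ x, σ x = x ^ q) (hσ : ∀ x, σ (σ x) = x)
    (hη : η ^ (q + 1) = 1) :
    pts W ∩ (tau q F η '' pts W) = ∅ ↔ ∀ w ∈ W, w ≠ 0 → semiInv σ η w ∉ W := by
  have hη0 : η ≠ 0 := by rintro rfl; simp at hη
  rw [Set.eq_empty_iff_forall_notMem]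
  constructor
  · intro h w hw hw0 hT
    have hT0 := semiInv_ne_zero hσ hη0 hw0
    exact h (Projectivization.mk F _ hT0) ⟨(mk_mem_pts hT0).2 hT, _, (mk_mem_pts hw0).2 hw,
      tau_mk hq hσ hη hw0 hT0⟩
  · rintro h _ ⟨hP, Q, hQ, rfl⟩
    induction Q using Projectivization.ind with
    | h w hw =>
      have hT0 := semiInv_ne_zero hσ hη0 hw
      rw [tau_mk hq hσ hη hw hT0, mk_mem_pts] at hP
      exact h w ((mk_mem_pts hw).1 hQ) hw hP

lemma pts_inter_SigmaSet_eq_empty (hq : ∀ x, σ x = x ^ q) (hσ : ∀ x, σ (σ x) = x)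
    (hη0 : η ≠ 0) (hW : ∀ w ∈ W, w ≠ 0 → semiInv σ η w ∉ W) :
    pts W ∩ SigmaSet q F η = ∅ := by
  rw [Set.eq_empty_iff_forall_notMem]
  rintro P ⟨hP, hS⟩
  obtain ⟨v, hv, hfix, rfl⟩ := (mem_SigmaSet_iff hq hσ hη0 P).1 hS
  have := (mk_mem_pts hv).1 hP
  exact hW v this hv (hfix.symm ▸ this)

lemma eq_zero_of_add_semiInv (hW : ∀ w ∈ W, w ≠ 0 → semiInv σ η w ∉ W) {u u' : Fin 4 → F}
    (hu : u ∈ W) (hu' : u' ∈ W) (h : u + semiInv σ η u' = 0) : u' = 0 := by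
  by_contra h0
  apply hW u' hu' h0
  rw [← neg_eq_of_add_eq_zero_right h]
  exact W.neg_mem hu

lemma span_semiInv_smul {w : Fin 4 → F} {c : F} (hc : c ≠ 0) :
    Submodule.span F {c • w, semiInv σ η (c • w)} = Submodule.span F {w, semiInv σ η w} := by
  have hσc : σ c ≠ 0 := by simpa using hc
  rw [semiInv_smul, Submodule.span_insert, Submodule.span_insert,
    Submodule.span_singleton_smul_eq (Ne.isUnit hc),
    Submodule.span_singleton_smul_eq (Ne.isUnit hσc)]

lemma semiInv_sub (α : F) (v w : Fin 4 → F) :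
    semiInv σ α (v - w) = semiInv σ α v - semiInv σ α w := by
  apply vec4_ext <;> simp [semiInv] <;> ring

lemma eq_of_fixed_add (hσ : ∀ x, σ (σ x) = x) (hη0 : η ≠ 0)
    (hW : ∀ w ∈ W, w ≠ 0 → semiInv σ η w ∉ W) {u u' : Fin 4 → F} (hu : u ∈ W) (hu' : u' ∈ W)
    (hfix : semiInv σ η (u + semiInv σ η u') = u + semiInv σ η u') : u = u' := by
  refine sub_eq_zero.1 (eq_zero_of_add_semiInv hW (W.sub_mem hu' hu) (W.sub_mem hu hu') ?_)
  rw [semiInv_add, semiInv_semiInv hσ hη0] at hfix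
  rw [semiInv_sub]
  rw [← sub_eq_zero] at hfix
  rw [← hfix]
  abel

/-- The vectors `w ∈ W` whose joining line with the conjugate carries a given fixed vector. -/
lemma exists_smul_of_fixed_mem (hσ : ∀ x, σ (σ x) = x) (hη0 : η ≠ 0)
    (hW : ∀ w ∈ W, w ≠ 0 → semiInv σ η w ∉ W) {w v : Fin 4 → F} (hw : w ∈ W)
    (hfix : semiInv σ η v = v) (hv : v ∈ Submodule.span F {w, semiInv σ η w}) :
    ∃ c : F, v = c • w + semiInv σ η (c • w) := by
  obtain ⟨a, b, rfl⟩ := Submodule.mem_span_pair.1 hv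
  have hb : b • semiInv σ η w = semiInv σ η (σ b • w) := by rw [semiInv_smul, hσ]
  rw [hb] at hfix ⊢
  have := eq_of_fixed_add hσ hη0 hW (W.smul_mem a hw) (W.smul_mem _ hw) hfix
  exact ⟨a, by rw [← this]⟩

lemma exists_eq_add_semiInv (hσ : ∀ x, σ (σ x) = x) (hη0 : η ≠ 0)
    (hfr : Module.finrank F W = 2) (hW : ∀ w ∈ W, w ≠ 0 → semiInv σ η w ∉ W)
    {v : Fin 4 → F} (hfix : semiInv σ η v = v) : ∃ w ∈ W, v = w + semiInv σ η w := by
  obtain ⟨x, y, hxy, rfl⟩ := exists_linearIndependent_pair hfr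
  have hli : LinearIndependent F ![semiInv σ η x, semiInv σ η y] := by
    rw [LinearIndependent.pair_iff] at hxy ⊢
    intro s t hst
    have := hxy (σ s) (σ t) (by
      rw [← semiInv_zero (σ := σ) η, ← hst, semiInv_add, semiInv_smul, semiInv_smul,
        semiInv_semiInv hσ hη0, semiInv_semiInv hσ hη0])
    simpa using this
  have hmem : ∀ z ∈ Submodule.span F {semiInv σ η x, semiInv σ η y},
      ∃ z' ∈ Submodule.span F {x, y}, z = semiInv σ η z' := by
    intro z hz
    obtain ⟨s, t, rfl⟩ := Submodule.mem_span_pair.1 hz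
    exact ⟨σ s • x + σ t • y, Submodule.mem_span_pair.2 ⟨_, _, rfl⟩, by
      rw [semiInv_add, semiInv_smul, semiInv_smul, hσ, hσ]⟩
  have hdis : Disjoint (Submodule.span F {x, y})
      (Submodule.span F {semiInv σ η x, semiInv σ η y}) := by
    rw [Submodule.disjoint_def]
    intro z hz hz'
    obtain ⟨z', hz'', rfl⟩ := hmem z hz'
    by_contra hz0
    exact hW z' hz'' (by rintro rfl; exact hz0 (semiInv_zero _)) hz
  obtain ⟨u, hu, u', hu', rfl⟩ := exists_add_eq_of_disjoint hfr (finrank_span_pair hli) hdis v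
  obtain ⟨t, ht, rfl⟩ := hmem u' hu'
  exact ⟨u, hu, by rw [eq_of_fixed_add hσ hη0 hW hu ht hfix]⟩

lemma isSpreadOfSigma_Sspread [Fintype F] (hq2 : 2 ≤ q) (hF : Fintype.card F = q ^ 2)
    (hq : ∀ x, σ x = x ^ q) (hσ : ∀ x, σ (σ x) = x) (hne : ∃ c, σ c ≠ c)
    (hη : η ^ (q + 1) = 1) (hfr : Module.finrank F W = 2)
    (hW : ∀ w ∈ W, w ≠ 0 → semiInv σ η w ∉ W) :
    IsSpreadOfSigma q F η (Sspread q F η (pts W)) := by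
  have hη0 : η ≠ 0 := by rintro rfl; simp at hη
  refine ⟨?_, ?_, ?_⟩
  · intro m hm
    obtain ⟨w, hw, hw0, rfl⟩ := (mem_Sspread_iff hq hσ hη).1 hm
    obtain ⟨x, y, hx, hy, hxy, hs⟩ := exists_fixed_pair_of_semiInv hσ hne hη0
      (linearIndependent_semiInv hW hw hw0)
    rw [hs]
    exact isLineOfSigma_pts hq2 hF hq hσ hη0 hx hy hxy
  · intro m hm m' hm' hmm
    by_contra hint
    apply hmm
    obtain ⟨P, hP, hP'⟩ := Set.nonempty_iff_ne_empty.2 hint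
    obtain ⟨w, hw, hw0, rfl⟩ := (mem_Sspread_iff hq hσ hη).1 hm
    obtain ⟨w', hw', hw0', rfl⟩ := (mem_Sspread_iff hq hσ hη).1 hm'
    obtain ⟨v, hv, hfix, rfl⟩ := (mem_SigmaSet_iff hq hσ hη0 P).1 hP.2
    obtain ⟨c, hc⟩ := exists_smul_of_fixed_mem hσ hη0 hW hw hfix ((mk_mem_pts hv).1 hP.1)
    obtain ⟨c', hc'⟩ := exists_smul_of_fixed_mem hσ hη0 hW hw' hfix ((mk_mem_pts hv).1 hP'.1)
    have hcc : c • w = c' • w' := by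
      rw [← sub_eq_zero]
      refine eq_zero_of_add_semiInv hW (W.sub_mem (W.smul_mem c hw) (W.smul_mem c' hw'))
        (W.sub_mem (W.smul_mem c hw) (W.smul_mem c' hw')) ?_
      rw [semiInv_sub, ← sub_eq_zero.2 (hc.symm.trans hc')]
      abel
    have hc0 : c ≠ 0 := by rintro rfl; exact hv (by simpa [semiInv_zero] using hc)
    have hc0' : c' ≠ 0 := by rintro rfl; exact hv (by simpa [semiInv_zero] using hc')
    rw [← span_semiInv_smul hc0, hcc, span_semiInv_smul hc0']
  · ext P
    constructor
    · rintro ⟨m, hm, hP⟩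
      obtain ⟨w, -, -, rfl⟩ := (mem_Sspread_iff hq hσ hη).1 hm
      exact hP.2
    · intro hS
      obtain ⟨v, hv, hfix, rfl⟩ := (mem_SigmaSet_iff hq hσ hη0 P).1 hS
      obtain ⟨w, hw, hvw⟩ := exists_eq_add_semiInv hσ hη0 hfr hW hfix
      have hw0 : w ≠ 0 := by rintro rfl; exact hv (by simpa [semiInv_zero] using hvw)
      exact ⟨_, (mem_Sspread_iff hq hσ hη).2 ⟨w, hw, hw0, rfl⟩,
        (mk_mem_pts hv).2 (Submodule.mem_span_pair.2 ⟨1, 1, by simpa using hvw.symm⟩), hS⟩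

lemma mem_Rreg_iff (hq : ∀ x, σ x = x ^ q) (hσ : ∀ x, σ (σ x) = x)
    (hne : ∃ c, σ c ≠ c) (hη : η ^ (q + 1) = 1) (hW : ∀ w ∈ W, w ≠ 0 → semiInv σ η w ∉ W)
    {m : Set (Pt F)} : m ∈ Rreg q F η (pts W) ↔
      ∃ a b : F, (a ≠ 0 ∨ b ≠ 0) ∧ m = pts (rSub σ a b) ∩ SigmaSet q F η ∧
        ∃ w ∈ W, w ≠ 0 ∧ w ∈ rSub σ a b := by
  have hη0 : η ≠ 0 := by rintro rfl; simp at hη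
  constructor
  · rintro ⟨hD, hS⟩
    obtain ⟨a, b, hab, rfl⟩ := (mem_Dspread_iff hq hσ).1 hD
    obtain ⟨w, hw, hw0, heq⟩ := (mem_Sspread_iff hq hσ hη).1 hS
    refine ⟨a, b, hab, rfl, w, hw, hw0, ?_⟩
    obtain ⟨x, y, hx, hy, hxy, hs⟩ := exists_fixed_pair_of_semiInv hσ hne hη0
      (linearIndependent_semiInv hW hw hw0)
    have hle : Submodule.span F {w, semiInv σ η w} ≤ rSub σ a b := by
      rw [hs]
      refine span_le_of_inter_subset hq hσ hη0 hx hy ?_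
      rw [← hs, ← heq]
      exact Set.inter_subset_left
    exact hle (Submodule.subset_span (by simp))
  · rintro ⟨a, b, hab, rfl, w, hw, hw0, hwr⟩
    refine ⟨(mem_Dspread_iff hq hσ).2 ⟨a, b, hab, rfl⟩,
      (mem_Sspread_iff hq hσ hη).2 ⟨w, hw, hw0, ?_⟩⟩
    rw [← eq_span_pair (finrank_rSub hab) hwr (semiInv_mem_rSub hwr hσ)
      (linearIndependent_semiInv hW hw hw0)]

end Sspread

/-- The full Desarguesian spread is not a regulus. -/
lemma not_isRegulusOfSigma_Dspread [Fintype F] (hq3 : 3 ≤ q) (hF : Fintype.card F = q ^ 2)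
    (hq : ∀ x, σ x = x ^ q) (hσ : ∀ x, σ (σ x) = x) {η : F} :
    ¬ IsRegulusOfSigma q F η (Dspread q F η) := by
  rintro ⟨m1, m2, m3, h1, -, -, -, -, -, hR⟩
  have hmeet : ∀ a : F, ∃ P ∈ m1, P ∈ pts (rSub σ a 1) := by
    intro a
    have hD : pts (rSub σ a 1) ∩ SigmaSet q F η ∈ Dspread q F η :=
      (mem_Dspread_iff hq hσ).2 ⟨a, 1, Or.inr one_ne_zero, rfl⟩
    rw [hR] at hD
    obtain ⟨P, hP, hP1⟩ := hD.2.1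
    exact ⟨P, hP1, hP.1⟩
  choose g hg hgr using hmeet
  have hinj : Function.Injective g := by
    intro a b hab
    have ha := hgr a
    have hb := hgr b
    rw [← hab] at hb
    rw [← (g a).mk_rep, mk_mem_pts] at ha hb
    simpa using cross_eq_of_mem_rSub (Or.inr one_ne_zero) (g a).rep_nonzero ha hb
  obtain ⟨s, -, -, hcard⟩ := h1
  have hle : (Set.range g).ncard ≤ m1.ncard :=
    Set.ncard_le_ncard (Set.range_subset_iff.2 hg) (Set.finite_of_ncard_pos (by omega))
  rw [Set.ncard_range_of_injective hinj, Nat.card_eq_fintype_card, hF, hcard] at hle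
  nlinarith

lemma eq_of_two_common_points {η : F} {m m' : Set (Pt F)} (hm : IsLineOfSigma q F η m)
    (hm' : IsLineOfSigma q F η m') {P Q : Pt F} (hPQ : P ≠ Q) (hP : P ∈ m) (hQ : Q ∈ m)
    (hP' : P ∈ m') (hQ' : Q ∈ m') : m = m' := by
  obtain ⟨_, ⟨W, hW, rfl⟩, rfl, -⟩ := hm
  obtain ⟨_, ⟨W', hW', rfl⟩, rfl, -⟩ := hm'
  have hli : LinearIndependent F ![P.rep, Q.rep] := by
    apply linearIndependent_of_mk_ne P.rep_nonzero Q.rep_nonzero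
    rwa [P.mk_rep, Q.mk_rep]
  have key : ∀ {R : Pt F} {V : Submodule F (Fin 4 → F)}, R ∈ pts V → R.rep ∈ V := by
    intro R V h
    rwa [← R.mk_rep, mk_mem_pts] at h
  have h1 := eq_span_pair hW (key hP.1) (key hQ.1) hli
  have h2 := eq_span_pair hW' (key hP'.1) (key hQ'.1) hli
  rw [h1, h2]

/-- A regulus of `Σ_η` contains two lines other than any given one. -/
lemma IsRegulusOfSigma.exists_pair_ne [Fintype F] (hq3 : 3 ≤ q) (hF : Fintype.card F = q ^ 2)
    (hq : ∀ x, σ x = x ^ q) (hσ : ∀ x, σ (σ x) = x) (hne : ∃ c, σ c ≠ c) {η : F} (hη0 : η ≠ 0)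
    {R : Set (Set (Pt F))} (hR : IsRegulusOfSigma q F η R) (m0 : Set (Pt F)) :
    ∃ m ∈ R, ∃ m' ∈ R, m ≠ m0 ∧ m' ≠ m0 ∧ m ≠ m' := by
  obtain ⟨m1, m2, m3, h1, h2, h3, h12, h13, h23, rfl⟩ := hR
  have htr := fun P (hP : P ∈ m1) =>
    exists_transversal (by omega) hF hq hσ hne hη0 h1 h2 h3 h12 h13 h23 hP
  choose! f hf hPf hf2 hf3 using htr
  have hcard : m1.ncard = q + 1 := by obtain ⟨_, -, -, h⟩ := h1; exact h
  have hinj : Set.InjOn f m1 := by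
    intro P hP Q hQ hPQ
    by_contra hne'
    have := eq_of_two_common_points (hf P hP) h1 hne' (hPf P hP) (hPQ ▸ hPf Q hQ) hP hQ
    have h := hf2 P hP
    rw [this, h12] at h
    exact Set.not_nonempty_empty h
  have hfin : m1.Finite := Set.finite_of_ncard_pos (by omega)
  have himg : (f '' m1).ncard = q + 1 := by rw [hinj.ncard_image, hcard]
  have hdiff : 1 < ((f '' m1) \ {m0}).ncard := by
    have := Set.le_ncard_sdiff {m0} (f '' m1)
    rw [Set.ncard_singleton, himg] at this
    omega
  obtain ⟨m, m', ⟨⟨P, hP, rfl⟩, hm⟩, ⟨⟨Q, hQ, rfl⟩, hm'⟩, hmm⟩ :=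
    (Set.one_lt_ncard_iff (hfin.image f).sdiff).1 hdiff
  exact ⟨_, ⟨hf P hP, ⟨P, hPf P hP, hP⟩, hf2 P hP, hf3 P hP⟩,
    _, ⟨hf Q hQ, ⟨Q, hPf Q hQ, hQ⟩, hf2 Q hQ, hf3 Q hQ⟩, hm, hm', hmm⟩

end Spreads

section Transversals

variable {q : ℕ} {F : Type} [Field F] {σ : F →+* F}

/-- The subspace spanned by `(1, 0, m, 0)` and `(a, 1, s aᑫ, s)`. -/
def lSub (σ : F →+* F) (m s a : F) : Submodule F (Fin 4 → F) :=
  Submodule.span F {![1, 0, m, 0], ![a, 1, s * σ a, s]}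

lemma linearIndependent_lSub (m s a : F) :
    LinearIndependent F ![![1, 0, m, 0], ![a, 1, s * σ a, s]] := by
  rw [LinearIndependent.pair_iff]
  intro c d h
  have h0 := congrFun h 0
  have h1 := congrFun h 1
  simp at h0 h1
  subst h1
  simpa using h0

lemma finrank_lSub (m s a : F) : Module.finrank F (lSub σ m s a) = 2 :=
  finrank_span_pair (linearIndependent_lSub m s a)

lemma mem_lSub {m s a : F} {v : Fin 4 → F} :
    v ∈ lSub σ m s a ↔ v 2 = m * v 0 + (s * σ a - m * a) * v 1 ∧ v 3 = s * v 1 := by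
  rw [lSub, Submodule.mem_span_pair]
  constructor
  · rintro ⟨c, d, rfl⟩
    constructor <;> simp <;> ring
  · rintro ⟨h2, h3⟩
    refine ⟨v 0 - a * v 1, v 1, ?_⟩
    apply vec4_ext <;> simp [h2, h3] <;> ring

lemma fst_mem_lSub (m s a : F) : ![1, 0, m, 0] ∈ lSub σ m s a := Submodule.subset_span (by simp)

lemma snd_mem_lSub (m s a : F) : ![a, 1, s * σ a, s] ∈ lSub σ m s a :=
  Submodule.subset_span (by simp)

lemma exists_fixed_pair_lSub (hσ : ∀ x, σ (σ x) = x) (hne : ∃ c, σ c ≠ c) {α : F} (hα : α ≠ 0)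
    {m s : F} (hm : σ m * m = σ α * α) (hs : σ s * s = σ α * α) (a : F) :
    ∃ x y, semiInv σ α x = x ∧ semiInv σ α y = y ∧ LinearIndependent F ![x, y] ∧
      lSub σ m s a = Submodule.span F {x, y} := by
  have hσα : σ α ≠ 0 := by simpa using hα
  have hli := linearIndependent_lSub (σ := σ) m s a
  have he : semiInv σ α ![1, 0, m, 0] = (σ m / σ α) • ![1, 0, m, 0] := by
    apply vec4_ext <;> simp [semiInv]
    field_simp
    linear_combination -hm
  have hf : semiInv σ α ![a, 1, s * σ a, s] = (σ s / σ α) • ![a, 1, s * σ a, s] := by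
    apply vec4_ext <;> simp [semiInv, hσ] <;> field_simp
    · linear_combination -σ a * hs
    · linear_combination -hs
  obtain ⟨c, hc, hx⟩ := exists_fixed_smul hσ hne hα (by
    intro h; simpa using congrFun h 0) he
  obtain ⟨d, hd, hy⟩ := exists_fixed_smul hσ hne hα (by
    intro h; simpa using congrFun h 1) hf
  have hli' : LinearIndependent F ![c • ![1, 0, m, 0], d • ![a, 1, s * σ a, s]] := by
    rw [LinearIndependent.pair_iff] at hli ⊢
    intro t r h
    rw [smul_smul, smul_smul] at h
    have := hli _ _ h
    simpa [hc, hd] using this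
  exact ⟨_, _, hx, hy, hli', eq_span_pair (finrank_lSub m s a)
    (Submodule.smul_mem _ _ (fst_mem_lSub m s a)) (Submodule.smul_mem _ _ (snd_mem_lSub m s a))
    hli'⟩

lemma norm_eq (hq : ∀ x, σ x = x ^ q) (x : F) : σ x * x = x ^ (q + 1) := by
  rw [hq, pow_succ]

lemma pts_lSub_ne_rU1 (m s a : F) : pts (lSub σ m s a) ≠ rU1 F := by
  intro h
  rw [rU1_eq_pts (σ := σ)] at h
  have hmem := snd_mem_lSub (σ := σ) m s a
  rw [pts_injective h, mem_rSub] at hmem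
  obtain ⟨c, d, hcd⟩ := hmem
  simpa using congrFun hcd 1

lemma pts_lSub_mem_pencil [Fintype F] (hq2 : 2 ≤ q) (hF : Fintype.card F = q ^ 2)
    (hq : ∀ x, σ x = x ^ q) (hσ : ∀ x, σ (σ x) = x) (hne : ∃ c, σ c ≠ c) {α u v : F} (hα : α ≠ 0)
    (hu : u ^ (q + 1) = 1) (hv : v ^ (q + 1) = 1) (a : F) :
    pts (lSub σ (α * u) (α * v) a) ∈ pencil q F α u v := by
  refine ⟨isLine_pts_span_pair (linearIndependent_lSub _ _ _),
    (mk_mem_pts _).2 (fst_mem_lSub _ _ _), ?_, ?_⟩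
  · intro P hP
    rw [← P.mk_rep, mk_mem_pts, mem_lSub] at hP
    exact hP.2
  · obtain ⟨x, y, hx, hy, hxy, hs⟩ := exists_fixed_pair_lSub hσ hne hα (m := α * u) (s := α * v)
      (by simp only [norm_eq hq, mul_pow, hu, mul_one])
      (by simp only [norm_eq hq, mul_pow, hv, mul_one]) a
    rw [hs]
    exact ncard_pts_inter_SigmaSet hq2 hF hq hσ hα hx hy hxy

lemma exists_lSub_of_mem_pencil (hq2 : 2 ≤ q)
    (hq : ∀ x, σ x = x ^ q) (hσ : ∀ x, σ (σ x) = x) {α u v : F} (hα : α ≠ 0)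
    {ℓ : Set (Pt F)} (hℓ : ℓ ∈ pencil q F α u v \ {rU1 F}) :
    ∃ a, ℓ = pts (lSub σ (α * u) (α * v) a) := by
  obtain ⟨⟨⟨W, hW, rfl⟩, hP, hplane, hcard⟩, hnot⟩ := hℓ
  obtain ⟨x, y, hx, hy, hxy, hWs⟩ := exists_fixed_pair hq2 hq hσ hα hW hcard
  have heW : ![1, 0, α * u, 0] ∈ W := (mk_mem_pts _).1 hP
  have h3 : ∀ w ∈ W, w 3 = α * v * w 1 := by
    intro w hw
    by_cases hw0 : w = 0
    · simp [hw0]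
    · have := hplane ((mk_mem_pts hw0).2 hw)
      obtain ⟨c, hc⟩ := Projectivization.exists_smul_eq_mk_rep F w hw0
      change (Projectivization.mk F w hw0).rep 3 =
        α * v * (Projectivization.mk F w hw0).rep 1 at this
      rw [← hc] at this
      simp only [Pi.smul_apply, Units.smul_def, smul_eq_mul] at this
      apply mul_left_cancel₀ c.ne_zero
      linear_combination this
  have key : ∃ z ∈ W, semiInv σ α z = z ∧ z 1 ≠ 0 := by
    have hxW : x ∈ W := hWs ▸ Submodule.subset_span (by simp)
    have hyW : y ∈ W := hWs ▸ Submodule.subset_span (by simp)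
    by_contra! hcon
    have hle : W ≤ rSub σ 1 0 := by
      rw [hWs, Submodule.span_le]
      have haux : ∀ z ∈ W, semiInv σ α z = z → z ∈ rSub σ 1 0 := by
        intro z hz hfix
        have hz1 := hcon z hz hfix
        have hz3 := h3 z hz
        exact mem_rSub.2 ⟨z 0, z 2, by apply vec4_ext <;> simp [hz1, hz3]⟩
      rintro z (rfl | rfl)
      · exact haux _ hxW hx
      · exact haux _ hyW hy
    apply hnot
    have : W = rSub σ 1 0 :=
      Submodule.eq_of_le_of_finrank_eq hle (by rw [hW, finrank_rSub (Or.inl one_ne_zero)])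
    rw [Set.mem_singleton_iff, rU1_eq_pts (σ := σ), ← this]
    rfl
  obtain ⟨z, hz, hfix, hz1⟩ := key
  have hσz1 : σ (z 1) ≠ 0 := by simpa using hz1
  have e2 : α * σ (z 0) = z 2 := by simpa [semiInv] using congrFun hfix 2
  have e3 : α * σ (z 1) = z 3 := by simpa [semiInv] using congrFun hfix 3
  have hvz : v * z 1 = σ (z 1) := by
    apply mul_left_cancel₀ hα
    rw [e3, h3 z hz, mul_assoc]
  have hv0 : v ≠ 0 := by
    rintro rfl
    exact hσz1 (by rw [← hvz, zero_mul])
  refine ⟨z 0 / z 1, ?_⟩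
  have hf : ![z 0 / z 1, 1, α * v * σ (z 0 / z 1), α * v] ∈ W := by
    have hz' : ![z 0 / z 1, 1, α * v * σ (z 0 / z 1), α * v] = (z 1)⁻¹ • z := by
      apply vec4_ext <;> simp [← e2, h3 z hz, ← hvz] <;> field_simp
    rw [hz']
    exact W.smul_mem _ hz
  have := eq_span_pair hW heW hf (linearIndependent_lSub _ _ _)
  rw [lSub, ← this]
  rfl

section

variable {η : F}

lemma semiInv_apply_of_norm_one (hη : σ η * η = 1) (v : Fin 4 → F) :
    semiInv σ η v = η • ![σ (v 2), σ (v 3), σ (v 0), σ (v 1)] := by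
  have hση : σ η ≠ 0 := left_ne_zero_of_mul_eq_one hη
  apply vec4_ext <;> simp [semiInv] <;> field_simp
  · linear_combination -σ (v 2) * hη
  · linear_combination -σ (v 3) * hη

lemma image_tau_pts (hq : ∀ x, σ x = x ^ q) (hσ : ∀ x, σ (σ x) = x)
    (hη : η ^ (q + 1) = 1) {W W' : Submodule F (Fin 4 → F)}
    (h : ∀ v ∈ W, semiInv σ η v ∈ W') (h' : ∀ v ∈ W', semiInv σ η v ∈ W) :
    tau q F η '' pts W = pts W' := by
  have hη0 : η ≠ 0 := by rintro rfl; simp at hη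
  ext P
  constructor
  · rintro ⟨Q, hQ, rfl⟩
    induction Q using Projectivization.ind with
    | h w hw =>
      rw [tau_mk hq hσ hη hw (semiInv_ne_zero hσ hη0 hw), mk_mem_pts]
      exact h w ((mk_mem_pts hw).1 hQ)
  · intro hP
    induction P using Projectivization.ind with
    | h w hw =>
      have hT := semiInv_ne_zero hσ hη0 hw
      refine ⟨_, (mk_mem_pts hT).2 (h' w ((mk_mem_pts hw).1 hP)), ?_⟩
      rw [tau_mk hq hσ hη hT (semiInv_ne_zero hσ hη0 hT)]
      congr 1
      exact semiInv_semiInv hσ hη0 w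

lemma image_tau_image_tau (hq : ∀ x, σ x = x ^ q) (hσ : ∀ x, σ (σ x) = x)
    (hη : η ^ (q + 1) = 1) (s : Set (Pt F)) : tau q F η '' (tau q F η '' s) = s := by
  have hη0 : η ≠ 0 := by rintro rfl; simp at hη
  rw [Set.image_image, Set.image_congr (g := id), Set.image_id]
  intro P _
  induction P using Projectivization.ind with
  | h w hw =>
    have hT := semiInv_ne_zero hσ hη0 hw
    rw [tau_mk hq hσ hη hw hT, tau_mk hq hσ hη hT (semiInv_ne_zero hσ hη0 hT), id]
    congr 1
    exact semiInv_semiInv hσ hη0 w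

lemma semiInv_mem_lSub (hσ : ∀ x, σ (σ x) = x) (hη : σ η * η = 1) {m s a : F} (hm : m ≠ 0)
    (hs : s ≠ 0) {v : Fin 4 → F} (hv : v ∈ lSub σ m s a) :
    semiInv σ η v ∈ lSub σ (σ m)⁻¹ (σ s)⁻¹ a := by
  have hσm : σ m ≠ 0 := by simpa using hm
  have hσs : σ s ≠ 0 := by simpa using hs
  rw [mem_lSub] at hv ⊢
  rw [semiInv_apply_of_norm_one hη]
  simp [hv.1, hv.2, hσ]
  constructor <;> field_simp
  ring

lemma image_tau_lSub (hq : ∀ x, σ x = x ^ q) (hσ : ∀ x, σ (σ x) = x)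
    (hη : η ^ (q + 1) = 1) {m s : F} (hm : m ≠ 0) (hs : s ≠ 0) (a : F) :
    tau q F η '' pts (lSub σ m s a) = pts (lSub σ (σ m)⁻¹ (σ s)⁻¹ a) := by
  have hη1 : σ η * η = 1 := by rw [norm_eq hq, hη]
  refine image_tau_pts hq hσ hη (fun v hv => semiInv_mem_lSub hσ hη1 hm hs hv) ?_
  intro v hv
  have := semiInv_mem_lSub hσ hη1 (by simpa using hm) (by simpa using hs) hv
  simpa [hσ] using this

lemma semiInv_notMem_lSub (hη : σ η * η = 1) {m s : F}
    (hms : σ m * m = σ s * s) (hm1 : σ m * m ≠ 1) (a : F) :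
    ∀ w ∈ lSub σ m s a, w ≠ 0 → semiInv σ η w ∉ lSub σ m s a := by
  have hη0 : η ≠ 0 := right_ne_zero_of_mul_eq_one hη
  intro w hw hw0 hT
  rw [semiInv_apply_of_norm_one hη] at hT
  rw [mem_lSub] at hw hT
  simp at hT
  obtain ⟨h2, h3⟩ := hw
  obtain ⟨t2, t3⟩ := hT
  have hw1 : w 1 = 0 := by
    have : η * (1 - σ m * m) * σ (w 1) = 0 := by
      rw [h3, map_mul] at t3
      rw [hms]
      linear_combination t3
    simpa [hη0, sub_eq_zero, hm1.symm] using this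
  rw [hw1, mul_zero] at h3
  rw [hw1, mul_zero, add_zero] at h2
  have hw00 : w 0 = 0 := by
    have : η * (1 - σ m * m) * σ (w 0) = 0 := by
      rw [h2, h3, map_mul, map_zero] at t2
      linear_combination t2
    simpa [hη0, sub_eq_zero, hm1.symm] using this
  apply hw0
  apply vec4_ext <;> simp [hw1, hw00, h2, h3]

lemma disjoint_lSub {κ z z' : F} (hκ : κ ≠ 0) (hz : z ≠ z') (a : F) :
    Disjoint (lSub σ z (z * κ) a) (lSub σ z' (z' * κ) a) := by
  rw [Submodule.disjoint_def]
  intro v hv hv'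
  rw [mem_lSub] at hv hv'
  have hzz := sub_ne_zero.2 hz
  have h1 : v 1 = 0 := by
    have : (z - z') * κ * v 1 = 0 := by linear_combination hv'.2 - hv.2
    simpa [hzz, hκ] using this
  have h0 : v 0 = 0 := by
    have : (z - z') * v 0 = 0 := by
      rw [h1] at hv hv'
      linear_combination hv'.1 - hv.1
    simpa [hzz] using this
  apply vec4_ext <;> simp [h0, h1, hv.1, hv.2]

lemma pts_inter_eq_empty {W W' : Submodule F (Fin 4 → F)} (h : Disjoint W W')
    (S S' : Set (Pt F)) : (pts W ∩ S) ∩ (pts W' ∩ S') = ∅ := by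
  rw [Set.eq_empty_iff_forall_notMem]
  rintro P ⟨⟨h₁, -⟩, h₂, -⟩
  rw [← P.mk_rep, mk_mem_pts] at h₁ h₂
  exact P.rep_nonzero (Submodule.disjoint_def.1 h _ h₁ h₂)

/-- If `r_P` meets a line of the opposite regulus, it meets each of its lines of `Σ_η`. -/
lemma rSub_inter_lSub_nonempty (hq : ∀ x, σ x = x ^ q) (hσ : ∀ x, σ (σ x) = x)
    (hne : ∃ c, σ c ≠ c) (hη : σ η * η = 1) {m κ z a c d : F}
    (hm : m ≠ 0) (hκ : σ κ * κ = 1) (hz : σ z * z = 1) {w : Fin 4 → F}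
    (hw : w ∈ lSub σ m (m * κ) a) (hw0 : w ≠ 0) (hwr : w ∈ rSub σ c d) :
    ((pts (rSub σ c d) ∩ SigmaSet q F η) ∩
      (pts (lSub σ z (z * κ) a) ∩ SigmaSet q F η)).Nonempty := by
  have hη0 : η ≠ 0 := right_ne_zero_of_mul_eq_one hη
  obtain ⟨r, t, rfl⟩ := mem_rSub.1 hwr
  rw [mem_lSub] at hw
  simp at hw
  obtain ⟨h2, h3⟩ := hw
  have hr : r ≠ 0 := by
    rintro rfl
    apply hw0
    simp at h2 h3
    apply vec4_ext <;> simp [h2, h3]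
  have hcd : c ≠ 0 ∨ d ≠ 0 := by
    by_contra! h
    exact hw0 (by simp [h.1, h.2])
  obtain ⟨ρ, rfl⟩ : ∃ ρ, t = r * m * ρ := ⟨t / (r * m), by field_simp⟩
  have hc : ρ * σ c = c + (κ * σ a - a) * d := by
    apply mul_left_cancel₀ (mul_ne_zero hr hm)
    linear_combination h2
  have hd : ρ * σ d = κ * d := by
    apply mul_left_cancel₀ (mul_ne_zero hr hm)
    linear_combination h3
  have hρ : σ ρ * ρ = 1 := by
    by_cases hd0 : d = 0
    · have hc0 : c ≠ 0 := by tauto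
      rw [hd0, mul_zero, add_zero] at hc
      have hc' := congrArg σ hc
      rw [map_mul, hσ] at hc'
      apply mul_right_cancel₀ hc0
      rw [one_mul]
      linear_combination ρ * hc' + hc
    · have hd' := congrArg σ hd
      rw [map_mul, hσ, map_mul] at hd'
      apply mul_right_cancel₀ hd0
      rw [one_mul]
      linear_combination ρ * hd' + σ κ * hd + d * hκ
  have hv : ![c, d, z * ρ * σ c, z * ρ * σ d] ≠ 0 := by
    intro h
    have e0 := congrFun h 0
    have e1 := congrFun h 1
    simp at e0 e1
    tauto
  have hS : Projectivization.mk F _ hv ∈ SigmaSet q F η := by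
    rw [mk_mem_SigmaSet_iff hq hσ hne hη0]
    refine ⟨η * σ (z * ρ), ?_⟩
    have hzρ : σ z * σ ρ * (z * ρ) = 1 := by linear_combination hρ * (σ z * z) + hz
    rw [semiInv_apply_of_norm_one hη]
    apply vec4_ext <;> simp [hσ]
    · ring
    · ring
    · linear_combination -η * σ c * hzρ
    · linear_combination -η * σ d * hzρ
  refine ⟨_, ⟨(mk_mem_pts hv).2 (mem_rSub.2 ⟨1, z * ρ, by simp⟩), hS⟩, (mk_mem_pts hv).2 ?_, hS⟩
  rw [mem_lSub]
  simp
  constructor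
  · linear_combination z * hc
  · linear_combination z * hd

/-- A line of `Σ_η` meeting three lines of the opposite regulus is some `r_P ∩ Σ_η`. -/
lemma eq_rSub_of_meets (hq : ∀ x, σ x = x ^ q) (hσ : ∀ x, σ (σ x) = x)
    (hne : ∃ c, σ c ≠ c) (hη : σ η * η = 1) {κ z₁ z₂ z₃ a : F}
    (hκ : κ ≠ 0) (hz₁ : z₁ ≠ 0) (h12 : z₁ ≠ z₂) (h13 : z₁ ≠ z₃) (h23 : z₂ ≠ z₃)
    (m : F) {G : Submodule F (Fin 4 → F)} (hG : Module.finrank F G = 2)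
    (h1 : ((pts G ∩ SigmaSet q F η) ∩ (pts (lSub σ z₁ (z₁ * κ) a) ∩ SigmaSet q F η)).Nonempty)
    (h2 : ((pts G ∩ SigmaSet q F η) ∩ (pts (lSub σ z₂ (z₂ * κ) a) ∩ SigmaSet q F η)).Nonempty)
    (h3 : ((pts G ∩ SigmaSet q F η) ∩ (pts (lSub σ z₃ (z₃ * κ) a) ∩ SigmaSet q F η)).Nonempty) :
    ∃ c d : F, (c ≠ 0 ∨ d ≠ 0) ∧ G = rSub σ c d ∧
      ∃ w ∈ lSub σ m (m * κ) a, w ≠ 0 ∧ w ∈ rSub σ c d := by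
  have hη0 : η ≠ 0 := right_ne_zero_of_mul_eq_one hη
  have key : ∀ {z : F},
      ((pts G ∩ SigmaSet q F η) ∩ (pts (lSub σ z (z * κ) a) ∩ SigmaSet q F η)).Nonempty →
      ∃ v ∈ G, v ≠ 0 ∧ v ∈ lSub σ z (z * κ) a ∧ ∃ k : F, semiInv σ η v = k • v := by
    rintro z ⟨P, ⟨hPG, hS⟩, hPl, -⟩
    rw [← P.mk_rep, mk_mem_pts] at hPG hPl
    rw [← P.mk_rep, mk_mem_SigmaSet_iff hq hσ hne hη0] at hS
    exact ⟨P.rep, hPG, P.rep_nonzero, hPl, hS⟩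
  obtain ⟨v, hvG, hv0, hvl, k, hk⟩ := key h1
  obtain ⟨v', hvG', hv0', hvl', -⟩ := key h2
  obtain ⟨v'', hvG'', hv0'', hvl'', -⟩ := key h3
  have hli : LinearIndependent F ![v, v'] := by
    rw [LinearIndependent.pair_iff' hv0]
    rintro c rfl
    exact hv0' (Submodule.disjoint_def.1 (disjoint_lSub hκ h12 a) _
      (Submodule.smul_mem _ c hvl) hvl')
  have hspan := eq_span_pair hG hvG hvG' hli
  rw [hspan] at hvG''
  obtain ⟨c₁, c₂, rfl⟩ := Submodule.mem_span_pair.1 hvG''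
  have hc₁ : c₁ ≠ 0 := by
    rintro rfl
    rw [zero_smul, zero_add] at hvl'' hv0''
    exact hv0'' (Submodule.disjoint_def.1 (disjoint_lSub hκ h23 a) _
      (Submodule.smul_mem _ c₂ hvl') hvl'')
  have hc₂ : c₂ ≠ 0 := by
    rintro rfl
    rw [zero_smul, add_zero] at hvl'' hv0''
    exact hv0'' (Submodule.disjoint_def.1 (disjoint_lSub hκ h13 a) _
      (Submodule.smul_mem _ c₁ hvl) hvl'')
  rw [mem_lSub] at hvl hvl' hvl''
  simp at hvl''
  obtain ⟨a2, a3⟩ := hvl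
  obtain ⟨b2, b3⟩ := hvl'
  obtain ⟨d2, d3⟩ := hvl''
  have hz13 := sub_ne_zero.2 h13
  have hz23 := sub_ne_zero.2 h23
  obtain ⟨t, ht⟩ : ∃ t, t * (c₂ * (z₂ - z₃)) = -(c₁ * (z₁ - z₃)) :=
    ⟨-(c₁ * (z₁ - z₃)) / (c₂ * (z₂ - z₃)), by field_simp⟩
  have hcz : κ * (c₂ * (z₂ - z₃)) ≠ 0 := mul_ne_zero hκ (mul_ne_zero hc₂ hz23)
  have e1 : v' 1 = t * v 1 := by
    apply mul_left_cancel₀ hcz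
    rw [a3, b3] at d3
    linear_combination d3 - κ * v 1 * ht
  have e0 : v' 0 = t * v 0 := by
    apply mul_left_cancel₀ (mul_ne_zero hc₂ hz23)
    rw [a2, b2, e1] at d2
    linear_combination d2 - (v 0 + (κ * σ a - a) * v 1) * ht
  have hk0 : k ≠ 0 := by
    rintro rfl
    exact semiInv_ne_zero hσ hη0 hv0 (by rw [hk, zero_smul])
  rw [semiInv_apply_of_norm_one hη] at hk
  have k2 : η * σ (v 0) = k * v 2 := by simpa using congrFun hk 2
  have k3 : η * σ (v 1) = k * v 3 := by simpa using congrFun hk 3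
  have hv2 : v 2 = η / k * σ (v 0) := by field_simp; linear_combination -k2
  have hv3 : v 3 = η / k * σ (v 1) := by field_simp; linear_combination -k3
  have hcd : v 0 ≠ 0 ∨ v 1 ≠ 0 := by
    by_contra! h
    apply hv0
    apply vec4_ext <;> simp [hv2, hv3, h.1, h.2]
  have hvr : v ∈ rSub σ (v 0) (v 1) :=
    mem_rSub.2 ⟨1, η / k, by apply vec4_ext <;> simp [hv2, hv3]⟩
  have hvr' : v' ∈ rSub σ (v 0) (v 1) := by
    refine mem_rSub.2 ⟨t, z₂ / z₁ * t * (η / k), ?_⟩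
    apply vec4_ext
    · simp [e0]
    · simp [e1]
    · simp only [Matrix.cons_val]
      rw [mul_assoc _ (η / k), ← hv2, a2, b2, e0, e1]
      field_simp
    · simp only [Matrix.cons_val]
      rw [mul_assoc _ (η / k), ← hv3, a3, b3, e1]
      field_simp
  refine ⟨v 0, v 1, hcd, ?_, ![v 0, v 1, m / z₁ * v 2, m / z₁ * v 3], ?_, ?_, ?_⟩
  · rw [hspan, ← eq_span_pair (finrank_rSub hcd) hvr hvr' hli]
  · rw [mem_lSub]
    simp only [Matrix.cons_val]
    rw [a2, a3]
    constructor <;> field_simp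
  · intro h
    have g0 := congrFun h 0
    have g1 := congrFun h 1
    simp at g0 g1
    tauto
  · exact mem_rSub.2 ⟨1, m / z₁ * (η / k), by
      apply vec4_ext <;> simp [hv2, hv3] <;> ring⟩

end

end Transversals

section RegulusLines

variable {q : ℕ} {F : Type} [Field F] {σ : F →+* F} {η : F}

lemma rSub_eq_of_inter_eq (hq : ∀ x, σ x = x ^ q) (hσ : ∀ x, σ (σ x) = x) (hne : ∃ c, σ c ≠ c)
    (hη0 : η ≠ 0) {a b c d : F} (hab : a ≠ 0 ∨ b ≠ 0) (hcd : c ≠ 0 ∨ d ≠ 0)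
    (h : pts (rSub σ a b) ∩ SigmaSet q F η = pts (rSub σ c d) ∩ SigmaSet q F η) :
    rSub σ a b = rSub σ c d := by
  refine Submodule.eq_of_le_of_finrank_eq ?_ (by rw [finrank_rSub hab, finrank_rSub hcd])
  obtain ⟨x, y, hx, hy, -, hs⟩ := exists_fixed_pair_rSub hσ hne hη0 hab
  rw [hs] at h ⊢
  exact span_le_of_inter_subset hq hσ hη0 hx hy (h ▸ Set.inter_subset_left)

/-- An element of `R_ℓ` other than `r_{U₁} ∩ Σ_η` is `r_P ∩ Σ_η` with `P = (a, 1, 0, 0)`. -/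
lemma exists_of_mem_Rreg_of_ne (hq : ∀ x, σ x = x ^ q) (hσ : ∀ x, σ (σ x) = x)
    (hne : ∃ c, σ c ≠ c) (hη : η ^ (q + 1) = 1) {W : Submodule F (Fin 4 → F)}
    (hW : ∀ w ∈ W, w ≠ 0 → semiInv σ η w ∉ W) {n : Set (Pt F)} (hn : n ∈ Rreg q F η (pts W))
    (hn' : n ≠ rU1 F ∩ SigmaSet q F η) :
    ∃ a c d : F, n = pts (rSub σ a 1) ∩ SigmaSet q F η ∧
      ![c * a, c, d * σ a, d] ∈ W ∧ (c ≠ 0 ∨ d ≠ 0) := by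
  obtain ⟨a, b, hab, rfl, w, hw, hw0, hwr⟩ := (mem_Rreg_iff hq hσ hne hη hW).1 hn
  have hb : b ≠ 0 := by
    rintro rfl
    apply hn'
    have ha : a ≠ 0 := by simpa using hab
    have := rSub_smul (σ := σ) (a := 1) (b := 0) ha
    rw [mul_one, mul_zero] at this
    rw [this, rU1_eq_pts (σ := σ)]
  have hr : rSub σ a b = rSub σ (a / b) 1 := by
    have := rSub_smul (σ := σ) (a := a / b) (b := 1) hb
    rwa [mul_div_cancel₀ _ hb, mul_one] at this
  rw [hr] at hwr ⊢
  obtain ⟨c, d, rfl⟩ := mem_rSub.1 hwr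
  refine ⟨a / b, c, d, rfl, by simpa using hw, ?_⟩
  by_contra! h
  exact hw0 (by simp [h.1, h.2])

end RegulusLines

section Characterization

variable {q : ℕ} {F : Type} [Field F] [Fintype F] {σ : F →+* F} {η : F}

/-- The five conditions hold for the lines `lSub` joining points of equal norm `≠ 1`. -/
lemma spread_and_regulus_lSub (hq3 : 3 ≤ q) (hF : Fintype.card F = q ^ 2) (hq : ∀ x, σ x = x ^ q)
    (hσ : ∀ x, σ (σ x) = x) (hne : ∃ c, σ c ≠ c) (hη : η ^ (q + 1) = 1) {m s : F} (hm : m ≠ 0)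
    (hms : σ m * m = σ s * s) (hm1 : σ m * m ≠ 1) (a : F) :
    pts (lSub σ m s a) ∩ (tau q F η '' pts (lSub σ m s a)) = ∅ ∧
      pts (lSub σ m s a) ∩ SigmaSet q F η = ∅ ∧
      IsSpreadOfSigma q F η (Sspread q F η (pts (lSub σ m s a))) ∧
      IsRegulusOfSigma q F η (Rreg q F η (pts (lSub σ m s a))) ∧
      rU1 F ∩ SigmaSet q F η ∈ Rreg q F η (pts (lSub σ m s a)) := by
  have hη0 : η ≠ 0 := by rintro rfl; simp at hη
  have hη1 : σ η * η = 1 := by rw [norm_eq hq, hη]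
  have hW := semiInv_notMem_lSub hη1 hms hm1 a
  refine ⟨(pts_inter_image_tau_eq_empty_iff hq hσ hη).2 hW,
    pts_inter_SigmaSet_eq_empty hq hσ hη0 hW,
    isSpreadOfSigma_Sspread (by omega) hF hq hσ hne hη (finrank_lSub m s a) hW, ?_, ?_⟩
  · obtain ⟨κ, rfl⟩ : ∃ κ, s = m * κ := ⟨s / m, by field_simp⟩
    have hσm : σ m ≠ 0 := by simpa using hm
    have hκ : σ κ * κ = 1 := by
      apply mul_left_cancel₀ (mul_ne_zero hσm hm)
      rw [map_mul] at hms
      linear_combination -hms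
    have hκ0 : κ ≠ 0 := right_ne_zero_of_mul_eq_one hκ
    obtain ⟨z₁, z₂, z₃, hz₁, hz₂, hz₃, h12, h13, h23⟩ :=
      (Set.two_lt_ncard_iff (Set.toFinite _)).1
        (show 2 < {x : F | x ^ (q + 1) = 1}.ncard by
          rw [ncard_pow_add_one_eq_one (by omega) hF]; omega)
    have hnorm : ∀ {z : F}, z ∈ {x : F | x ^ (q + 1) = 1} → σ z * z = 1 := by
      intro z hz
      rw [norm_eq hq]
      exact hz
    have hline : ∀ {z : F}, z ∈ {x : F | x ^ (q + 1) = 1} →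
        IsLineOfSigma q F η (pts (lSub σ z (z * κ) a) ∩ SigmaSet q F η) := by
      intro z hz
      have hz1 := hnorm hz
      obtain ⟨x, y, hx, hy, hxy, hs⟩ := exists_fixed_pair_lSub hσ hne hη0 (m := z) (s := z * κ)
        (by rw [hz1, hη1]) (by rw [map_mul, hη1]; linear_combination σ κ * κ * hz1 + hκ) a
      rw [hs]
      exact isLineOfSigma_pts (by omega) hF hq hσ hη0 hx hy hxy
    refine ⟨_, _, _, hline hz₁, hline hz₂, hline hz₃,
      pts_inter_eq_empty (disjoint_lSub hκ0 h12 a) _ _,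
      pts_inter_eq_empty (disjoint_lSub hκ0 h13 a) _ _,
      pts_inter_eq_empty (disjoint_lSub hκ0 h23 a) _ _, ?_⟩
    ext n
    rw [mem_Rreg_iff hq hσ hne hη hW]
    constructor
    · rintro ⟨c, d, hcd, rfl, w, hw, hw0, hwr⟩
      exact ⟨isLineOfSigma_rSub (by omega) hF hq hσ hne hη0 hcd,
        rSub_inter_lSub_nonempty hq hσ hne hη1 hm hκ (hnorm hz₁) hw hw0 hwr,
        rSub_inter_lSub_nonempty hq hσ hne hη1 hm hκ (hnorm hz₂) hw hw0 hwr,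
        rSub_inter_lSub_nonempty hq hσ hne hη1 hm hκ (hnorm hz₃) hw hw0 hwr⟩
    · rintro ⟨⟨_, ⟨G, hG, rfl⟩, rfl, -⟩, g1, g2, g3⟩
      obtain ⟨c, d, hcd, rfl, hw⟩ := eq_rSub_of_meets hq hσ hne hη1 hκ0
        (right_ne_zero_of_mul_eq_one (hnorm hz₁)) h12 h13 h23 m hG g1 g2 g3
      exact ⟨c, d, hcd, rfl, hw⟩
  · rw [mem_Rreg_iff hq hσ hne hη hW]
    exact ⟨1, 0, Or.inl one_ne_zero, by rw [rU1_eq_pts (σ := σ)], _, fst_mem_lSub m s a,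
      fun h => by simpa using congrFun h 0, mem_rSub.2 ⟨1, m, by simp⟩⟩

/-- If `W` contains a point of each `r_P`, then `R_ℓ` is all of `D_η`, so it is no regulus. -/
lemma false_of_forall_meets (hq3 : 3 ≤ q) (hF : Fintype.card F = q ^ 2)
    (hq : ∀ x, σ x = x ^ q) (hσ : ∀ x, σ (σ x) = x)
    (hne : ∃ c, σ c ≠ c) (hη : η ^ (q + 1) = 1) {W : Submodule F (Fin 4 → F)}
    (hW : ∀ w ∈ W, w ≠ 0 → semiInv σ η w ∉ W)
    (hR : IsRegulusOfSigma q F η (Rreg q F η (pts W)))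
    (h : ∀ a b : F, (a ≠ 0 ∨ b ≠ 0) → ∃ w ∈ W, w ≠ 0 ∧ w ∈ rSub σ a b) : False := by
  have heq : Rreg q F η (pts W) = Dspread q F η := by
    refine Set.Subset.antisymm Set.inter_subset_left ?_
    intro n hn
    obtain ⟨a, b, hab, rfl⟩ := (mem_Dspread_iff hq hσ).1 hn
    exact (mem_Rreg_iff hq hσ hne hη hW).2 ⟨a, b, hab, rfl, h a b hab⟩
  rw [heq] at hR
  exact not_isRegulusOfSigma_Dspread hq3 hF hq hσ hR

/-- A line satisfying the spread and regulus conditions is some `lSub`. -/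
lemma exists_eq_lSub (hq3 : 3 ≤ q) (hF : Fintype.card F = q ^ 2)
    (hq : ∀ x, σ x = x ^ q) (hσ : ∀ x, σ (σ x) = x)
    (hne : ∃ c, σ c ≠ c) (hη : η ^ (q + 1) = 1) {W : Submodule F (Fin 4 → F)}
    (hfr : Module.finrank F W = 2) (hW : ∀ w ∈ W, w ≠ 0 → semiInv σ η w ∉ W)
    (hR : IsRegulusOfSigma q F η (Rreg q F η (pts W)))
    (hU : rU1 F ∩ SigmaSet q F η ∈ Rreg q F η (pts W)) :
    ∃ m s a : F, m ≠ 0 ∧ s ≠ 0 ∧ σ m * m = σ s * s ∧ σ m * m ≠ 1 ∧ W = lSub σ m s a := by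
  have hη0 : η ≠ 0 := by rintro rfl; simp at hη
  obtain ⟨l₀, m₀, hw₀, h₀⟩ : ∃ l₀ m₀ : F, ![l₀, 0, m₀, 0] ∈ W ∧ (l₀ ≠ 0 ∨ m₀ ≠ 0) := by
    obtain ⟨a, b, hab, heq, w, hw, hw0, hwr⟩ := (mem_Rreg_iff hq hσ hne hη hW).1 hU
    rw [rU1_eq_pts (σ := σ)] at heq
    rw [← rSub_eq_of_inter_eq hq hσ hne hη0 (Or.inl one_ne_zero) hab heq] at hwr
    obtain ⟨c, d, rfl⟩ := mem_rSub.1 hwr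
    refine ⟨c, d, by simpa using hw, ?_⟩
    by_contra! h
    exact hw0 (by simp [h.1, h.2])
  obtain ⟨n, hn, n', hn', hn0, hn0', hnn⟩ :=
    hR.exists_pair_ne hq3 hF hq hσ hne hη0 (rU1 F ∩ SigmaSet q F η)
  obtain ⟨a, l₁, m₁, rfl, hw₁, h₁⟩ := exists_of_mem_Rreg_of_ne hq hσ hne hη hW hn hn0
  obtain ⟨a', l₂, m₂, rfl, hw₂, h₂⟩ := exists_of_mem_Rreg_of_ne hq hσ hne hη hW hn' hn0'
  have haa : a' - a ≠ 0 := by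
    intro h
    exact hnn (by rw [sub_eq_zero.1 h])
  have hσaa : σ a' - σ a ≠ 0 := by
    rw [← map_sub]
    exact (map_ne_zero σ).2 haa
  have hli : LinearIndependent F ![![l₀, 0, m₀, 0], ![l₁ * a, l₁, m₁ * σ a, m₁]] := by
    rw [LinearIndependent.pair_iff]
    intro c d h
    have e0 := congrFun h 0
    have e1 := congrFun h 1
    have e2 := congrFun h 2
    have e3 := congrFun h 3
    simp at e0 e1 e2 e3
    have hd : d = 0 := h₁.elim e1.resolve_right e3.resolve_right
    subst hd
    simp at e0 e2
    exact ⟨h₀.elim e0.resolve_right e2.resolve_right, rfl⟩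
  have hspan := eq_span_pair hfr hw₀ hw₁ hli
  obtain ⟨c, d, hcd⟩ := Submodule.mem_span_pair.1 (hspan ▸ hw₂)
  have e0 := congrFun hcd 0
  have e1 := congrFun hcd 1
  have e2 := congrFun hcd 2
  have e3 := congrFun hcd 3
  simp at e0 e1 e2 e3
  have f0 : c * l₀ = d * l₁ * (a' - a) := by linear_combination e0 - a' * e1
  have f2 : c * m₀ = d * m₁ * (σ a' - σ a) := by linear_combination e2 - σ a' * e3
  have hd : d ≠ 0 := by
    rintro rfl
    exact h₂.elim (fun h => h (by rw [← e1, zero_mul])) (fun h => h (by rw [← e3, zero_mul]))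
  have hc : c ≠ 0 := by
    rintro rfl
    rw [zero_mul, eq_comm] at f0 f2
    exact h₁.elim (fun h => mul_ne_zero (mul_ne_zero hd h) haa f0)
      (fun h => mul_ne_zero (mul_ne_zero hd h) hσaa f2)
  by_cases hm₀ : m₀ = 0
  · exfalso
    have hm₁ : m₁ = 0 := by
      by_contra h
      exact mul_ne_zero (mul_ne_zero hd h) hσaa (by rw [← f2, hm₀, mul_zero])
    have hl₀ : l₀ ≠ 0 := h₀.resolve_right (not_not.2 hm₀)
    have hl₁ : l₁ ≠ 0 := h₁.resolve_right (not_not.2 hm₁)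
    refine false_of_forall_meets hq3 hF hq hσ hne hη hW hR fun x y hxy =>
      ⟨![x, y, 0, 0], ?_, vec_fst_ne_zero hxy, mem_rSub.2 ⟨1, 0, by simp⟩⟩
    rw [hspan, Submodule.mem_span_pair]
    refine ⟨(x - y * a) / l₀, y / l₁, ?_⟩
    apply vec4_ext <;> simp [hm₀, hm₁] <;> field_simp
    ring
  by_cases hl₀ : l₀ = 0
  · exfalso
    have hl₁ : l₁ = 0 := by
      by_contra h
      exact mul_ne_zero (mul_ne_zero hd h) haa (by rw [← f0, hl₀, mul_zero])
    have hm₁ : m₁ ≠ 0 := h₁.resolve_left (not_not.2 hl₁)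
    refine false_of_forall_meets hq3 hF hq hσ hne hη hW hR fun x y hxy =>
      ⟨![0, 0, σ x, σ y], ?_, ?_, mem_rSub.2 ⟨0, 1, by simp⟩⟩
    · rw [hspan, Submodule.mem_span_pair]
      refine ⟨(σ x - σ y * σ a) / m₀, σ y / m₁, ?_⟩
      apply vec4_ext <;> simp [hl₀, hl₁] <;> field_simp
      ring
    · intro h
      have g2 := congrFun h 2
      have g3 := congrFun h 3
      simp at g2 g3
      exact hxy.elim (· g2) (· g3)
  have hl₁ : l₁ ≠ 0 := by
    rintro rfl
    exact mul_ne_zero hc hl₀ (by rw [f0, mul_zero, zero_mul])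
  have hm₁ : m₁ ≠ 0 := by
    rintro rfl
    exact mul_ne_zero hc hm₀ (by rw [f2, mul_zero, zero_mul])
  have he : ![1, 0, m₀ / l₀, 0] ∈ W := by
    have : ![1, 0, m₀ / l₀, 0] = l₀⁻¹ • ![l₀, 0, m₀, 0] := by
      apply vec4_ext <;> simp [hl₀]
      field_simp
    rw [this]
    exact W.smul_mem _ hw₀
  have hf : ![a, 1, m₁ / l₁ * σ a, m₁ / l₁] ∈ W := by
    have : ![a, 1, m₁ / l₁ * σ a, m₁ / l₁] = l₁⁻¹ • ![l₁ * a, l₁, m₁ * σ a, m₁] := by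
      apply vec4_ext <;> simp [hl₁] <;> field_simp
    rw [this]
    exact W.smul_mem _ hw₁
  have hms : m₀ / l₀ * (a' - a) = m₁ / l₁ * (σ a' - σ a) := by
    field_simp
    apply mul_left_cancel₀ (mul_ne_zero hc hd)
    linear_combination d * l₁ * (a' - a) * f2 - d * m₁ * (σ a' - σ a) * f0
  refine ⟨m₀ / l₀, m₁ / l₁, a, div_ne_zero hm₀ hl₀, div_ne_zero hm₁ hl₁, ?_, ?_,
    eq_span_pair hfr he hf (linearIndependent_lSub _ _ _)⟩
  · have hms' := congrArg σ hms
    simp only [map_mul, map_sub, hσ] at hms'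
    apply mul_right_cancel₀ (mul_ne_zero haa hσaa)
    linear_combination σ (m₀ / l₀) * (σ a' - σ a) * hms +
      m₁ / l₁ * (σ a' - σ a) * hms'
  · intro hm1
    apply hW _ he fun h => by simpa using congrFun h 0
    have hη1 : σ η * η = 1 := by rw [norm_eq hq, hη]
    have : semiInv σ η ![1, 0, m₀ / l₀, 0] = (η * σ (m₀ / l₀)) • ![1, 0, m₀ / l₀, 0] := by
      rw [semiInv_apply_of_norm_one hη1]
      generalize m₀ / l₀ = m at hm1
      apply vec4_ext <;> simp
      linear_combination -η * hm1
    rw [this]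
    exact W.smul_mem _ he

end Characterization

section Membership

variable {q : ℕ} {F : Type} [Field F] {σ : F →+* F}

/-- A line lies in `L` iff it joins points `(1, 0, m, 0)` and `(a, 1, s aᑫ, s)` such that
`m` and `s` have the same norm, in `N`. -/
lemma mem_iUnion_pencil_iff [Fintype F] (hq2 : 2 ≤ q) (hF : Fintype.card F = q ^ 2)
    (hq : ∀ x, σ x = x ^ q) (hσ : ∀ x, σ (σ x) = x) (hne : ∃ c, σ c ≠ c) {I : Set F}
    (hI : (0 : F) ∉ I) {ℓ : Set (Pt F)} :
    ℓ ∈ ⋃ α ∈ I, ⋃ u ∈ Uset q F, ⋃ v ∈ Uset q F, (pencil q F α u v \ {rU1 F}) ↔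
      ∃ m s a : F, m ^ (q + 1) ∈ normIm q F I ∧ s ^ (q + 1) = m ^ (q + 1) ∧
        ℓ = pts (lSub σ m s a) := by
  simp only [Set.mem_iUnion]
  constructor
  · rintro ⟨α, hα, u, hu, v, hv, h⟩
    have hα0 : α ≠ 0 := fun h0 => hI (h0 ▸ hα)
    obtain ⟨a, rfl⟩ := exists_lSub_of_mem_pencil hq2 hq hσ hα0 h
    have hu' : u ^ (q + 1) = 1 := hu
    have hv' : v ^ (q + 1) = 1 := hv
    refine ⟨α * u, α * v, a, ⟨α, hα, ?_⟩, ?_, rfl⟩ <;> simp only [mul_pow, hu', hv', mul_one]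
  · rintro ⟨m, s, a, ⟨α, hα, hn⟩, hs, rfl⟩
    have hα0 : α ≠ 0 := fun h0 => hI (h0 ▸ hα)
    have hn' : α ^ (q + 1) = m ^ (q + 1) := hn
    have hαq : α ^ (q + 1) ≠ 0 := pow_ne_zero _ hα0
    have hu : (m / α) ^ (q + 1) = 1 := by rw [div_pow, ← hn', div_self hαq]
    have hv : (s / α) ^ (q + 1) = 1 := by rw [div_pow, hs, ← hn', div_self hαq]
    have := pts_lSub_mem_pencil hq2 hF hq hσ hne hα0 hu hv a
    rw [mul_div_cancel₀ _ hα0, mul_div_cancel₀ _ hα0] at this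
    exact ⟨α, hα, _, hu, _, hv, this, pts_lSub_ne_rU1 m s a⟩

end Membership

/-- Characterization of the lines `ℓ` for which `S_ℓ` is a spread of `Σ_η` with
`D_η ∩ S_ℓ` a regulus through `r_{U₁} ∩ Σ_η`: at least one of `ℓ`, `τ_η(ℓ)` lies in `L`. -/
theorem statement6 (q : ℕ) (hq : IsPrimePow q) (hq3 : 3 ≤ q) (F : Type) [Field F] [Fintype F]
    (hF : Fintype.card F = q ^ 2) (I : Set F) (hI : IsIndexSet q F I)
    (η : F) (hηU : η ^ (q + 1) = 1)
    (ℓ : Set (Pt F)) (hℓ : isLine F ℓ) :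
    (ℓ ∩ (tau q F η '' ℓ) = ∅ ∧ ℓ ∩ SigmaSet q F η = ∅ ∧
      IsSpreadOfSigma q F η (Sspread q F η ℓ) ∧
      IsRegulusOfSigma q F η (Rreg q F η ℓ) ∧
      rU1 F ∩ SigmaSet q F η ∈ Rreg q F η ℓ) ↔
    (ℓ ∈ ⋃ α ∈ I, ⋃ u ∈ Uset q F, ⋃ v ∈ Uset q F, (pencil q F α u v \ {rU1 F}) ∨
      tau q F η '' ℓ ∈ ⋃ α ∈ I, ⋃ u ∈ Uset q F, ⋃ v ∈ Uset q F, (pencil q F α u v \ {rU1 F})) := by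
  obtain ⟨σ, hσq⟩ := exists_ringHom_eq_pow hq hF
  have hσ : ∀ x, σ (σ x) = x := by
    intro x
    rw [hσq, hσq, ← pow_mul, ← sq, ← hF, FiniteField.pow_card]
  have hq2 : 2 ≤ q := by omega
  have hne : ∃ c, σ c ≠ c := by
    by_contra! h
    have hcard := ncard_pow_eq_self hq2 hF
    have huniv : {x : F | x ^ q = x} = Set.univ := by
      ext x
      simp [← hσq, h x]
    rw [huniv, Set.ncard_univ, Nat.card_eq_fintype_card, hF] at hcard
    nlinarith
  obtain ⟨hI0, -, -, hI1, hIN, -⟩ := hI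
  have hinv : ∀ {x : F}, (σ x)⁻¹ ^ (q + 1) = (x ^ (q + 1))⁻¹ := by
    intro x
    rw [inv_pow, ← norm_eq hσq, ← norm_eq hσq, hσ, mul_comm]
  rw [mem_iUnion_pencil_iff hq2 hF hσq hσ hne hI0, mem_iUnion_pencil_iff hq2 hF hσq hσ hne hI0]
  have hfive : ∀ {m s : F} (a : F), m ≠ 0 → s ^ (q + 1) = m ^ (q + 1) → m ^ (q + 1) ≠ 1 → _ :=
    fun {m s} a hm hs hm1 => spread_and_regulus_lSub (s := s) hq3 hF hσq hσ hne hηU hm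
      (by rw [norm_eq hσq, norm_eq hσq, hs]) (by rwa [norm_eq hσq]) a
  have hN0 : ∀ {m : F}, m ^ (q + 1) ∈ normIm q F I → m ≠ 0 := by
    rintro m ⟨α, hα, h⟩ rfl
    have : α = 0 := by simpa using h
    exact hI0 (this ▸ hα)
  constructor
  · obtain ⟨W, hW, rfl⟩ := hℓ
    rintro ⟨h1, -, -, h4, h5⟩
    obtain ⟨m, s, a, hm, hs, hms, hm1, rfl⟩ := exists_eq_lSub hq3 hF hσq hσ hne hηU hW
      ((pts_inter_image_tau_eq_empty_iff hσq hσ hηU).1 h1) h4 h5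
    rw [norm_eq hσq] at hm1
    rw [norm_eq hσq, norm_eq hσq] at hms
    have hmem : m ^ (q + 1) ∈ FqSet q F \ {0} := by
      refine ⟨?_, pow_ne_zero _ hm⟩
      change (m ^ (q + 1)) ^ q = m ^ (q + 1)
      rw [← hσq, ← norm_eq hσq, map_mul, hσ, mul_comm]
    rw [← hIN] at hmem
    obtain (hN | ⟨n, hN, hn⟩) | h := hmem
    · exact Or.inl ⟨m, s, a, hN, hms.symm, rfl⟩
    · refine Or.inr ⟨(σ m)⁻¹, (σ s)⁻¹, a, ?_, ?_, image_tau_lSub hσq hσ hηU hm hs a⟩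
      · rwa [hinv, ← hn, inv_inv]
      · rw [hinv, hinv, hms]
    · exact absurd h hm1
  · rintro (⟨m, s, a, hN, hs, rfl⟩ | ⟨m, s, a, hN, hs, h⟩)
    · exact hfive a (hN0 hN) hs fun h => hI1 (h ▸ hN)
    · have hm := hN0 hN
      have hs0 : s ≠ 0 := by
        rintro rfl
        rw [zero_pow (by omega), eq_comm, pow_eq_zero_iff (by omega)] at hs
        exact hm hs
      have hη0 : η ≠ 0 := by rintro rfl; simp at hηU
      obtain rfl : ℓ = pts (lSub σ (σ m)⁻¹ (σ s)⁻¹ a) := by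
        rw [← image_tau_lSub hσq hσ hηU hm hs0, ← h, image_tau_image_tau hσq hσ hηU]
      refine hfive a (by simpa using hm) (by rw [hinv, hinv, hs]) ?_
      rw [hinv, ne_eq, inv_eq_one]
      exact fun h => hI1 (h ▸ hN)
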